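/- Let s ∈ ℂ be a root of unity with s³ ≠ 1. Then the formal power series Ẽ(t,s) = ∑_{n≥0} (∑_{k∈ℤ} ẽ_{n,k} s^k) t^n ∈ ℂ[[t]] is algebraic over ℂ(t): there exists a nonzero polynomial P ∈ ℂ[X,Y] with P(t, Ẽ(t,s)) = 0 in ℂ[[t]]. -/

import Mathlib

open scoped BigOperators
noncomputable section

abbrev WSt : Type := ℤ × ℕ × ℕ

def cellStep (v w : WSt) : Prop :=
  w = (v.1, v.2.1 + 1, v.2.2 + 1) ∨
  (1 ≤ v.2.2 ∧ w = (v.1, v.2.1, v.2.2 - 1)) ∨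
  (1 ≤ v.2.1 ∧ w = (v.1, v.2.1 - 1, v.2.2)) ∨
  (v.2.1 = 0 ∧ w = (v.1 + 1, v.2.2, 0)) ∨
  (v.2.2 = 0 ∧ w = (v.1 - 1, 0, v.2.1 + 1))

def vertStep (v w : WSt) : Prop :=
  w = (v.1, v.2.1 + 1, v.2.2 + 1) ∨
  (1 ≤ v.2.2 ∧ w = (v.1, v.2.1, v.2.2 - 1)) ∨
  (1 ≤ v.2.1 ∧ w = (v.1, v.2.1 - 1, v.2.2)) ∨
  (v.2.1 = 0 ∧ 1 ≤ v.2.2 ∧ w = (v.1 + 1, v.2.2 - 1, 0)) ∨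
  (v.2.2 = 0 ∧ w = (v.1 - 1, 0, v.2.1 + 2))

def pathCount (step : WSt → WSt → Prop) (n : ℕ) (v : WSt) : ℕ :=
  Nat.card {p : Fin (n + 1) → WSt //
    p 0 = ((0 : ℤ), 0, 0) ∧ p (Fin.last n) = v ∧
    ∀ i : Fin n, step (p i.castSucc) (p i.succ)}

/-- number of cell-centred excursions of length `n` with winding angle `2πk/3` -/
def eCell (n : ℕ) (k : ℤ) : ℕ := pathCount cellStep n (k, 0, 0)

/-- number of vertex-centred walks of length `n` with winding angle `2πk/3` -/
def eVert (n : ℕ) (k : ℤ) : ℕ := pathCount vertStep n (k, 0, 0)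

/-- The series `T_k(u,q)`. -/
def Tk (k : ℕ) (u q : ℂ) : ℂ :=
  ∑' n : ℕ, (-1 : ℂ) ^ n * ((2 * n + 1 : ℕ) : ℂ) ^ k * q ^ (n * (n + 1) / 2) *
    (u ^ (n + 1) - (-1 : ℂ) ^ k * u ^ (-(n : ℤ)))

/-- Jacobi theta function θ₁₁. -/
def jTheta (z τ : ℂ) : ℂ :=
  ∑' n : ℤ, (-1 : ℂ) ^ n *
    Complex.exp (((2 * (n : ℂ) + 1) / 2) ^ 2 * Complex.I * (Real.pi : ℂ) * τ +
      (2 * (n : ℂ) + 1) * Complex.I * z)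

/-- derivative of θ with respect to z -/
def jTheta' (z τ : ℂ) : ℂ := deriv (fun w => jTheta w τ) z

namespace Kreweras
open PowerSeries

/-- The two power series roots of `ω² - (ξ - 1) ω + τ ξ³`, with an inverse of the first one. -/
structure Curve {R : Type*} [CommRing R] (τ : R) where
  w1 : R⟦X⟧
  w2 : R⟦X⟧
  i : R⟦X⟧
  sum : w1 + w2 = X - 1
  prod : w1 * w2 = C τ * X ^ 3
  inv : w1 * i = 1
  const : constantCoeff w1 = -1

theorem exists_catalan {R : Type*} [CommRing R] (u : R⟦X⟧) (hu : constantCoeff u = 0) :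
    ∃ c : R⟦X⟧, c = 1 + u * c ^ 2 := by
  have hs : HasSubst u := HasSubst.of_constantCoeff_zero' hu
  have h := congrArg (fun f => (substAlgHom hs (R := R)) (PowerSeries.map (Nat.castRingHom R) f))
    catalanSeries_sq_mul_X_add_one
  simp only [map_add, map_mul, map_pow, map_one, PowerSeries.map_X] at h
  rw [substAlgHom_X] at h
  exact ⟨substAlgHom hs (PowerSeries.map (Nat.castRingHom R) catalanSeries),
    by linear_combination -h⟩

theorem nonempty_curve {R : Type*} [CommRing R] (τ : R) : Nonempty (Curve τ) := by
  have h1 : IsUnit (X - 1 : R⟦X⟧) := by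
    rw [isUnit_iff_constantCoeff]; simp
  obtain ⟨j, hj⟩ := h1.exists_right_inv
  set u : R⟦X⟧ := C τ * X ^ 3 * j ^ 2 with hu
  have hu0 : constantCoeff u = 0 := by simp [hu]
  obtain ⟨c, hc⟩ := exists_catalan u hu0
  have h2 : IsUnit ((X - 1) * (1 - u * c)) := by
    rw [isUnit_iff_constantCoeff]; simp [hu0]
  obtain ⟨i, hi⟩ := h2.exists_right_inv
  refine ⟨⟨(X - 1) * (1 - u * c), (X - 1) * (u * c), i, by ring, ?_, hi, by simp [hu0]⟩⟩
  have e : (1 - u * c) * (u * c) = u := by linear_combination u * hc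
  calc (X - 1) * (1 - u * c) * ((X - 1) * (u * c))
      = (X - 1) ^ 2 * ((1 - u * c) * (u * c)) := by ring
    _ = ((X - 1) * j) ^ 2 * (C τ * X ^ 3) := by rw [e, hu]; ring
    _ = _ := by rw [hj]; ring

namespace Curve

variable {R : Type*} [CommRing R] {τ : R} (h : Curve τ)
include h

theorem constantCoeff_i : constantCoeff h.i = -1 := by
  have := congrArg constantCoeff h.inv
  simp only [map_mul, h.const, map_one] at this
  linear_combination -this

theorem constantCoeff_w2 : constantCoeff h.w2 = 0 := by
  have := congrArg constantCoeff h.sum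
  simp only [map_add, h.const, map_sub, map_one, constantCoeff_X] at this
  linear_combination this

theorem hasSubst : HasSubst (X * h.i) := HasSubst.of_constantCoeff_zero' (by simp)

/-- Substitution of `η = ξ / ω₁` for `ξ`. -/
def σ : R⟦X⟧ →ₐ[R] R⟦X⟧ := substAlgHom h.hasSubst

theorem σ_def (f : R⟦X⟧) : h.σ f = f.subst (X * h.i) := by
  rw [σ, coe_substAlgHom]

theorem σ_X : h.σ X = X * h.i := substAlgHom_X h.hasSubst

theorem σ_C (a : R) : h.σ (C a) = C a := h.σ.commutes a

theorem constantCoeff_σ (f : R⟦X⟧) : constantCoeff (h.σ f) = constantCoeff f := by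
  obtain ⟨g, hg⟩ : (X : R⟦X⟧) ∣ f - C (constantCoeff f) := by
    rw [X_dvd_iff]; simp
  have e : f = C (constantCoeff f) + X * g := by rw [← hg]; ring
  conv_lhs => rw [e]
  rw [map_add, map_mul, h.σ_C, h.σ_X]
  simp

theorem quad : h.w1 ^ 2 - (X - 1) * h.w1 + C τ * X ^ 3 = 0 := by
  rw [← h.prod, ← h.sum]; ring

theorem σ_w1 : h.σ h.w1 = h.i := by
  have h1 := congrArg h.σ h.quad
  simp only [map_add, map_sub, map_mul, map_pow, map_one, h.σ_C, h.σ_X, map_zero] at h1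
  have h2 : h.i ^ 2 - (X * h.i - 1) * h.i + C τ * (X * h.i) ^ 3 = 0 := by
    have := h.quad
    have e := h.inv
    linear_combination h.i ^ 3 * this + (-h.i ^ 2 * h.w1 + h.i ^ 2 * (X-1) - h.i) * e
  have hu : IsUnit (h.σ h.w1 + h.i - (X * h.i - 1)) := by
    rw [isUnit_iff_constantCoeff]
    simp [h.constantCoeff_σ, h.const, h.constantCoeff_i]
  have h3 : (h.σ h.w1 + h.i - (X * h.i - 1)) * (h.σ h.w1 - h.i) = 0 := by
    linear_combination h1 - h2
  rw [hu.mul_right_eq_zero] at h3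
  linear_combination h3

theorem σ_w2 : h.σ h.w2 = h.w2 * h.i := by
  have h1 := congrArg h.σ h.sum
  simp only [map_add, map_sub, map_one, h.σ_w1, h.σ_X] at h1
  linear_combination h1 - h.i * h.sum + h.inv

theorem σ_i : h.σ h.i = h.w1 := by
  have h1 := congrArg h.σ h.inv
  rw [map_mul, h.σ_w1, map_one] at h1
  linear_combination h.w1 * h1 - h.σ h.i * h.inv

theorem σ_σ (f : R⟦X⟧) : h.σ (h.σ f) = f := by
  have e : (X * h.i).subst (X * h.i) = (X : R⟦X⟧) := by
    rw [← h.σ_def, map_mul, h.σ_X, h.σ_i, mul_assoc, mul_comm h.i, h.inv, mul_one]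
  rw [h.σ_def f, h.σ_def, subst_comp_subst_apply h.hasSubst h.hasSubst, e, X_subst]

/-- Base change of the curve along a ring homomorphism. -/
@[simps]
def map {S : Type*} [CommRing S] (φ : R →+* S) : Curve (φ τ) where
  w1 := PowerSeries.map φ h.w1
  w2 := PowerSeries.map φ h.w2
  i := PowerSeries.map φ h.i
  sum := by rw [← map_add, h.sum]; simp
  prod := by rw [← map_mul, h.prod]; simp
  inv := by rw [← map_mul, h.inv]; simp
  const := by
    rw [← coeff_zero_eq_constantCoeff_apply, coeff_map, coeff_zero_eq_constantCoeff_apply, h.const]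
    simp

theorem map_σ {S : Type*} [CommRing S] (φ : R →+* S) (f : R⟦X⟧) :
    PowerSeries.map φ (h.σ f) = (h.map φ).σ (PowerSeries.map φ f) := by
  rw [σ_def, σ_def]
  have e : X * (h.map φ).i = PowerSeries.map φ (X * h.i) := by
    rw [map_mul, PowerSeries.map_X, map_i]
  rw [e]
  exact PowerSeries.map_subst (h := φ) h.hasSubst f

end Curve
end Kreweras

namespace Kreweras
open PowerSeries

section Division
variable {k : Type*} [Field k] (α β : PowerSeries (Polynomial k))

/-- Coefficients of the quotient of `β` by `α`. -/
def quotCoeff (n : ℕ) : Polynomial k :=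
  (coeff n β - ∑ i : Fin n, coeff (n - i) α * quotCoeff i) / coeff 0 α
termination_by n
decreasing_by exact i.2

theorem exists_quot_rem (hα : coeff 0 α ≠ 0) :
    ∃ e r : PowerSeries (Polynomial k), β = α * e + r ∧
      ∀ n, (coeff n r).degree < (coeff 0 α).degree := by
  refine ⟨mk (quotCoeff α β),
    mk fun n => (coeff n β - ∑ i : Fin n, coeff (n - i) α * quotCoeff α β i) % coeff 0 α, ?_, ?_⟩
  · ext1 n
    rw [map_add, mul_comm, coeff_mul, Finset.Nat.sum_antidiagonal_eq_sum_range_succ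
      (fun i j => coeff i (mk (quotCoeff α β)) * coeff j α), Finset.sum_range_succ,
      Finset.sum_range]
    simp only [coeff_mk, Nat.sub_self]
    have h1 : ∑ i : Fin n, quotCoeff α β i * coeff (n - i) α =
        ∑ i : Fin n, coeff (n - i) α * quotCoeff α β i :=
      Finset.sum_congr rfl fun i _ => mul_comm _ _
    rw [h1, mul_comm (quotCoeff α β n)]
    have h2 := EuclideanDomain.div_add_mod
      (coeff n β - ∑ i : Fin n, coeff (n - i) α * quotCoeff α β i) (coeff 0 α)
    have h3 : quotCoeff α β n =
      (coeff n β - ∑ i : Fin n, coeff (n - i) α * quotCoeff α β i) / coeff 0 α := by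
      rw [quotCoeff]
    rw [← h3] at h2
    linear_combination -h2
  · intro n
    rw [coeff_mk]
    exact EuclideanDomain.mod_lt _ hα

end Division

/-- Transposition of the two variables, from `k[x]⟦t⟧` to `k⟦t⟧⟦x⟧`. -/
def tr {k : Type*} [CommRing k] : PowerSeries (Polynomial k) →+* PowerSeries (PowerSeries k) where
  toFun α := mk fun n => mk fun j => (coeff j α).coeff n
  map_one' := by
    ext n j
    simp only [coeff_mk, coeff_one]
    by_cases hj : j = 0 <;> by_cases hn : n = 0 <;>
      simp [hj, hn, Polynomial.coeff_one, coeff_one]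
  map_zero' := by ext n j; simp
  map_add' a b := by ext n j; simp
  map_mul' a b := by
    ext n j
    simp only [coeff_mk, coeff_mul, Polynomial.finsetSum_coeff, Polynomial.coeff_mul, map_sum]
    rw [Finset.sum_comm]

theorem coeff_tr {k : Type*} [CommRing k] (α : PowerSeries (Polynomial k)) (n j : ℕ) :
    coeff j (coeff n (tr α)) = (coeff j α).coeff n := by
  simp [tr]

theorem tr_injective {k : Type*} [CommRing k] :
    Function.Injective (tr : PowerSeries (Polynomial k) → PowerSeries (PowerSeries k)) := by
  intro a b h
  ext j n
  rw [← coeff_tr, ← coeff_tr, h]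

theorem map_constantCoeff_tr {k : Type*} [CommRing k] (α : PowerSeries (Polynomial k)) :
    PowerSeries.map (constantCoeff (R := k)) (tr α) = (coeff 0 α : Polynomial k) := by
  ext n
  rw [coeff_map, ← coeff_zero_eq_constantCoeff_apply, coeff_tr, Polynomial.coeff_coe]

theorem tr_X {k : Type*} [CommRing k] : tr (X : PowerSeries (Polynomial k)) = C X := by
  ext n j
  rw [coeff_tr, coeff_X, coeff_C]
  by_cases hj : j = 1 <;> by_cases hn : n = 0 <;>
      simp [hj, hn, Polynomial.coeff_one, coeff_X]

theorem tr_C_X {k : Type*} [CommRing k] :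
    tr (C (Polynomial.X) : PowerSeries (Polynomial k)) = X := by
  ext n j
  rw [coeff_tr, coeff_X, coeff_C]
  by_cases hj : j = 0 <;> by_cases hn : n = 1 <;>
      simp [hj, hn, Polynomial.coeff_X, coeff_one, Ne.symm]

theorem tr_map_C {k : Type*} [CommRing k] (o : PowerSeries k) :
    tr (PowerSeries.map Polynomial.C o) = C o := by
  ext n j
  rw [coeff_tr, coeff_map, coeff_C, Polynomial.coeff_C]
  by_cases hn : n = 0 <;> simp [hn]

variable (K : Type*) [Field K] [Algebra (PowerSeries ℂ) K] [IsFractionRing (PowerSeries ℂ) K]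

/-- The variable `t` in the field of fractions. -/
def tt : K := algebraMap (PowerSeries ℂ) K X

/-- Transposition with coefficients extended to the field of fractions. -/
def trK : PowerSeries (Polynomial ℂ) →+* PowerSeries K :=
  (PowerSeries.map (algebraMap (PowerSeries ℂ) K)).comp tr

theorem tt_ne_zero : tt K ≠ 0 := by
  rw [tt, Ne, IsFractionRing.to_map_eq_zero_iff]
  exact X_ne_zero

variable {K}

theorem map_algebraMap_injective :
    Function.Injective (PowerSeries.map (algebraMap (PowerSeries ℂ) K)) :=
  PowerSeries.map_injective _ (IsFractionRing.injective _ _)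

theorem trK_apply (α : PowerSeries (Polynomial ℂ)) :
    trK K α = PowerSeries.map (algebraMap (PowerSeries ℂ) K) (tr α) := rfl

theorem trK_X : trK K X = C (tt K) := by
  rw [trK_apply, tr_X, map_C, tt]

theorem trK_C_X : trK K (C Polynomial.X) = X := by
  rw [trK_apply, tr_C_X, map_X]

theorem trK_map_C (o : PowerSeries ℂ) :
    trK K (PowerSeries.map Polynomial.C o) = C (algebraMap (PowerSeries ℂ) K o) := by
  rw [trK_apply, tr_map_C, map_C]

theorem exists_tt_pow_mul (c : K) :
    ∃ (N : ℕ) (o : PowerSeries ℂ), tt K ^ N * c = algebraMap (PowerSeries ℂ) K o := by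
  obtain ⟨x, y, hy, rfl⟩ := IsFractionRing.div_surjective (PowerSeries ℂ) c
  have hy0 : y ≠ 0 := nonZeroDivisors.ne_zero hy
  have hyK : algebraMap (PowerSeries ℂ) K y ≠ 0 := by
    rwa [Ne, IsFractionRing.to_map_eq_zero_iff]
  obtain ⟨N, u, hu⟩ : ∃ N : ℕ, ∃ u : PowerSeries ℂ, y * u = X ^ N := by
    obtain ⟨n, hn⟩ := IsDiscreteValuationRing.associated_pow_irreducible hy0
      (PowerSeries.X_prime (R := ℂ)).irreducible
    obtain ⟨u, hu⟩ := hn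
    exact ⟨n, u, hu⟩
  refine ⟨N, x * u, ?_⟩
  rw [tt, ← map_pow, ← hu, map_mul, map_mul]
  field_simp

variable (K) in
/-- Series of `K⟦ξ⟧` which, up to a power of `t`, are power series in `t` with polynomial
coefficients in `ξ`. -/
def TA : Subalgebra K (PowerSeries K) where
  carrier := {a | ∃ (N : ℕ) (α : PowerSeries (Polynomial ℂ)), C (tt K) ^ N * a = trK K α}
  mul_mem' := by
    rintro a b ⟨N, α, ha⟩ ⟨M, β, hb⟩
    exact ⟨N + M, α * β, by rw [map_mul, ← ha, ← hb]; ring⟩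
  add_mem' := by
    rintro a b ⟨N, α, ha⟩ ⟨M, β, hb⟩
    exact ⟨N + M, X ^ M * α + X ^ N * β, by
      rw [map_add, map_mul, map_mul, map_pow, map_pow, ← ha, ← hb, trK_X]; ring⟩
  algebraMap_mem' c := by
    obtain ⟨N, o, h⟩ := exists_tt_pow_mul c
    refine ⟨N, PowerSeries.map Polynomial.C o, ?_⟩
    rw [trK_map_C, ← h, map_mul, map_pow]
    rfl

theorem C_mem_TA (c : K) : C c ∈ TA K := (TA K).algebraMap_mem c

theorem trK_mem_TA (α : PowerSeries (Polynomial ℂ)) : trK K α ∈ TA K := ⟨0, α, by simp⟩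

theorem X_mem_TA : (X : PowerSeries K) ∈ TA K := by
  rw [← trK_C_X]; exact trK_mem_TA _

theorem coe_mem_TA (P : Polynomial K) : (P : PowerSeries K) ∈ TA K := by
  induction P using Polynomial.induction_on' with
  | add p q hp hq => rw [Polynomial.coe_add]; exact add_mem hp hq
  | monomial n a =>
    rw [← Polynomial.C_mul_X_pow_eq_monomial, Polynomial.coe_mul, Polynomial.coe_C,
      Polynomial.coe_pow, Polynomial.coe_X]
    exact mul_mem (C_mem_TA a) (pow_mem X_mem_TA n)

theorem mem_TA_of_X_mul {f : PowerSeries K} (h : X * f ∈ TA K) : f ∈ TA K := by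
  obtain ⟨N, α, hα⟩ := h
  refine ⟨N, mk fun n => (coeff n α).divX, ?_⟩
  have h0 : ∀ n, (coeff n α).coeff 0 = 0 := by
    intro n
    have h1 : coeff 0 (tr α) = 0 := by
      apply IsFractionRing.injective (PowerSeries ℂ) K
      rw [← coeff_map, ← trK_apply, ← hα, map_zero]
      simp
    rw [← coeff_tr, h1, map_zero]
  have h2 : α = C Polynomial.X * mk fun n => (coeff n α).divX := by
    ext1 n
    rw [coeff_C_mul, coeff_mk]
    have := Polynomial.X_mul_divX_add (coeff n α)
    rw [h0, Polynomial.C_0, add_zero] at this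
    exact this.symm
  have h3 : X * (C (tt K) ^ N * f) = X * trK K (mk fun n => (coeff n α).divX) := by
    conv_rhs => rw [← trK_C_X, ← map_mul, ← h2, ← hα]
    ring
  exact mul_left_cancel₀ X_ne_zero h3

theorem trK_injective : Function.Injective (trK K) :=
  map_algebraMap_injective.comp tr_injective

theorem exists_eq_X_pow_mul_pair {R : Type*} [CommRing R] {α β : PowerSeries R}
    (h : α ≠ 0 ∨ β ≠ 0) :
    ∃ (n : ℕ) (α' β' : PowerSeries R), α = X ^ n * α' ∧ β = X ^ n * β' ∧
      (coeff 0 α' ≠ 0 ∨ coeff 0 β' ≠ 0) := by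
  classical
  have hex : ∃ n, coeff n α ≠ 0 ∨ coeff n β ≠ 0 := by
    by_contra! hcon
    have e1 : α = 0 := by ext1 n; simpa using (hcon n).1
    have e2 : β = 0 := by ext1 n; simpa using (hcon n).2
    tauto
  have hn := Nat.find_spec hex
  have hmin : ∀ m < Nat.find hex, ¬ (coeff m α ≠ 0 ∨ coeff m β ≠ 0) :=
    fun m hm => Nat.find_min hex hm
  obtain ⟨α', hα'⟩ : X ^ Nat.find hex ∣ α := by
    rw [X_pow_dvd_iff]; intro m hm; have := hmin m hm; tauto
  obtain ⟨β', hβ'⟩ : X ^ Nat.find hex ∣ β := by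
    rw [X_pow_dvd_iff]; intro m hm; have := hmin m hm; tauto
  refine ⟨_, α', β', hα', hβ', ?_⟩
  generalize Nat.find hex = n at *
  subst hα' hβ'
  simpa [coeff_X_pow_mul'] using hn

theorem exists_normalized_pair {a b : PowerSeries K} (ha : a ∈ TA K) (hb : b ∈ TA K)
    (hab : a ≠ 0 ∨ b ≠ 0) :
    ∃ (u : K) (α β : PowerSeries (Polynomial ℂ)), u ≠ 0 ∧ C u * a = trK K α ∧
      C u * b = trK K β ∧ (coeff 0 α ≠ 0 ∨ coeff 0 β ≠ 0) := by
  obtain ⟨N, α, ha⟩ := ha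
  obtain ⟨M, β, hb⟩ := hb
  have ht := tt_ne_zero K
  have hC : (C (tt K) : PowerSeries K) ≠ 0 := by
    rwa [Ne, map_eq_zero_iff _ C_injective]
  have ha' : C (tt K) ^ (N + M) * a = trK K (X ^ M * α) := by
    rw [map_mul, map_pow, trK_X, ← ha]; ring
  have hb' : C (tt K) ^ (N + M) * b = trK K (X ^ N * β) := by
    rw [map_mul, map_pow, trK_X, ← hb]; ring
  have hne : X ^ M * α ≠ 0 ∨ X ^ N * β ≠ 0 := by
    rcases hab with h | h
    · left; intro h0
      rw [h0, map_zero] at ha'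
      exact mul_ne_zero (pow_ne_zero _ hC) h ha'
    · right; intro h0
      rw [h0, map_zero] at hb'
      exact mul_ne_zero (pow_ne_zero _ hC) h hb'
  obtain ⟨n, α', β', h1, h2, h3⟩ := exists_eq_X_pow_mul_pair hne
  have hinv : C (tt K ^ n)⁻¹ * C (tt K) ^ n = (1 : PowerSeries K) := by
    rw [← map_pow, ← map_mul, inv_mul_cancel₀ (pow_ne_zero _ ht), map_one]
  refine ⟨(tt K ^ n)⁻¹ * tt K ^ (N + M), α', β',
    mul_ne_zero (inv_ne_zero (pow_ne_zero _ ht)) (pow_ne_zero _ ht), ?_, ?_, h3⟩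
  · rw [map_mul, map_pow, mul_assoc, ha', h1, map_mul, map_pow, trK_X, ← mul_assoc, hinv, one_mul]
  · rw [map_mul, map_pow, mul_assoc, hb', h2, map_mul, map_pow, trK_X, ← mul_assoc, hinv, one_mul]

theorem exists_polynomial_add_mul {Q a : PowerSeries K} (hQ : Q ∈ TA K) (hQ0 : Q ≠ 0)
    (ha : a ∈ TA K) : ∃ P : Polynomial K, ∃ e ∈ TA K, a = P + Q * e := by
  obtain ⟨u, α, β', -, hα, hβ', h0⟩ := exists_normalized_pair hQ (zero_mem _) (Or.inl hQ0)
  have h0 : coeff 0 α ≠ 0 := by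
    rw [mul_zero, eq_comm, map_eq_zero_iff _ trK_injective] at hβ'
    subst hβ'
    simpa using h0
  obtain ⟨N, β, hβ⟩ := ha
  obtain ⟨e, r, her, hr⟩ := exists_quot_rem α β h0
  have ht := tt_ne_zero K
  obtain ⟨P, hP⟩ : ∃ P : Polynomial K, (P : PowerSeries K) = trK K r := by
    refine ⟨trunc (coeff 0 α).natDegree (trK K r), ?_⟩
    ext n
    rw [Polynomial.coeff_coe, coeff_trunc]
    split_ifs with hn
    · rfl
    · rw [trK_apply, coeff_map]
      have : coeff n (tr r) = 0 := by
        ext j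
        rw [coeff_tr, map_zero]
        apply Polynomial.coeff_eq_zero_of_degree_lt
        refine (hr j).trans_le ?_
        rw [Polynomial.degree_eq_natDegree h0]
        exact_mod_cast not_lt.mp hn
      rw [this, map_zero]
  refine ⟨Polynomial.C (tt K ^ N)⁻¹ * P, C ((tt K ^ N)⁻¹ * u) * trK K e,
    mul_mem (C_mem_TA _) (trK_mem_TA _), ?_⟩
  rw [Polynomial.coe_mul, hP, Polynomial.coe_C]
  have h1 : C (tt K ^ N)⁻¹ * (C (tt K) ^ N * a) = a := by
    rw [← map_pow, ← mul_assoc, ← map_mul, inv_mul_cancel₀ (pow_ne_zero _ ht), map_one, one_mul]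
  conv_lhs => rw [← h1, hβ, her, map_add, map_mul, ← hα]
  rw [map_mul]
  ring

end Kreweras

namespace Kreweras
open Polynomial

section Hom
variable {K : Type*} [Field K] (τ : K)

/-- The cubic `τ X³ + X - 1`. -/
def cub : K[X] := C τ * X ^ 3 + X - 1

/-- Homogenization with respect to `cub` (of weight two) and `X` (of weight one). -/
def hom (N : ℕ) (p : K[X]) : K[X] :=
  ∑ i ∈ Finset.range (N / 2 + 1), C (p.coeff i) * cub τ ^ i * X ^ (N - 2 * i)

/-- The discriminant factor. -/
def fac : K[X] := 2 - X + C τ * X ^ 3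

/-- The curve's discriminant. -/
def disc : K[X] := (X - 1) ^ 2 - 4 * C τ * X ^ 3

/-- The ramification cubic. -/
def ram : K[X] := C (-4) * X ^ 3 + X ^ 2 + C (18 * τ) * X + C (-4 * τ - 27 * τ ^ 2)

theorem hom_add (N : ℕ) (p q : K[X]) : hom τ N (p + q) = hom τ N p + hom τ N q := by
  simp only [hom, coeff_add, map_add, add_mul, Finset.sum_add_distrib]

theorem hom_C_mul (N : ℕ) (c : K) (p : K[X]) : hom τ N (C c * p) = C c * hom τ N p := by
  simp only [hom, coeff_C_mul, map_mul, Finset.mul_sum, mul_assoc]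

theorem hom_zero (N : ℕ) : hom τ N 0 = 0 := by simp [hom]

theorem hom_sub (N : ℕ) (p q : K[X]) : hom τ N (p - q) = hom τ N p - hom τ N q := by
  have := hom_add τ N (p - q) q
  rw [sub_add_cancel] at this
  rw [this]; ring

theorem algebraMap_hom (N : ℕ) (p : K[X]) (hp : 2 * p.natDegree ≤ N) :
    algebraMap K[X] (RatFunc K) (hom τ N p) =
      RatFunc.X ^ N * aeval (algebraMap K[X] (RatFunc K) (cub τ) / RatFunc.X ^ 2) p := by
  rw [aeval_eq_sum_range' (n := N / 2 + 1) (by omega), hom, map_sum, Finset.mul_sum]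
  refine Finset.sum_congr rfl fun i hi => ?_
  rw [Finset.mem_range] at hi
  have hX : (RatFunc.X : RatFunc K) ≠ 0 := RatFunc.X_ne_zero
  have hN : N = (N - 2 * i) + 2 * i := by omega
  have e : (RatFunc.X : RatFunc K) ^ N = RatFunc.X ^ (N - 2 * i) * RatFunc.X ^ (2 * i) := by
    rw [← pow_add, ← hN]
  rw [map_mul, map_mul, map_pow, map_pow, RatFunc.algebraMap_C, RatFunc.algebraMap_X,
    Algebra.smul_def, RatFunc.algebraMap_eq_C, e, div_pow, ← pow_mul]
  field_simp

theorem hom_mul {N M : ℕ} {p q : K[X]} (hp : 2 * p.natDegree ≤ N) (hq : 2 * q.natDegree ≤ M) :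
    hom τ (N + M) (p * q) = hom τ N p * hom τ M q := by
  apply RatFunc.algebraMap_injective K
  have h : 2 * (p * q).natDegree ≤ N + M := by
    have := natDegree_mul_le (p := p) (q := q); omega
  rw [map_mul, algebraMap_hom τ _ _ hp, algebraMap_hom τ _ _ hq, algebraMap_hom τ _ _ h, map_mul]
  ring

theorem hom_one (N : ℕ) : hom τ N 1 = X ^ N := by
  apply RatFunc.algebraMap_injective K
  rw [algebraMap_hom τ _ _ (by simp)]
  simp

theorem hom_pow {N : ℕ} {p : K[X]} (hp : 2 * p.natDegree ≤ N) (m : ℕ) :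
    hom τ (m * N) (p ^ m) = hom τ N p ^ m := by
  induction m with
  | zero => simp [hom_one]
  | succ m ih =>
    rw [add_mul, one_mul, pow_succ, hom_mul τ _ hp, ih, pow_succ]
    have := natDegree_pow_le (p := p) (n := m)
    calc 2 * (p ^ m).natDegree ≤ 2 * (m * p.natDegree) := by omega
      _ = m * (2 * p.natDegree) := by ring
      _ ≤ _ := Nat.mul_le_mul_left _ hp

theorem hom_eq_X_pow_mul {N d : ℕ} {p : K[X]} (hp : p.natDegree ≤ d) (hN : 2 * d ≤ N) :
    hom τ N p = X ^ (N - 2 * d) * hom τ (2 * d) p := by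
  have e : N = (N - 2 * d) + 2 * d := by omega
  conv_lhs => rw [e, ← one_mul p, hom_mul τ (by simp) (by omega), hom_one]

theorem coeff_zero_cub : (cub τ).coeff 0 = -1 := by simp [cub]

theorem coeff_zero_hom (d : ℕ) (p : K[X]) :
    (hom τ (2 * d) p).coeff 0 = (-1) ^ d * p.coeff d := by
  rw [hom, finsetSum_coeff, Finset.sum_eq_single_of_mem d (by simp)]
  · have h : (cub τ ^ d).coeff 0 = (-1) ^ d := by
      rw [coeff_zero_eq_eval_zero, eval_pow, ← coeff_zero_eq_eval_zero, coeff_zero_cub]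
    rw [mul_coeff_zero, mul_coeff_zero, h, Nat.sub_self, pow_zero, coeff_C_zero, coeff_one_zero]
    ring
  · intro i hi hne
    rw [Finset.mem_range] at hi
    have : 2 * d - 2 * i ≠ 0 := by omega
    simp [this, coeff_zero_eq_eval_zero]

theorem coeff_zero_hom_natDegree_ne {p : K[X]} (hp : p ≠ 0) :
    (hom τ (2 * p.natDegree) p).coeff 0 ≠ 0 := by
  rw [coeff_zero_hom]
  exact mul_ne_zero (pow_ne_zero _ (neg_ne_zero.mpr one_ne_zero)) (leadingCoeff_ne_zero.mpr hp)

theorem hom_ne_zero {N : ℕ} {p : K[X]} (hN : 2 * p.natDegree ≤ N) (hp : p ≠ 0) :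
    hom τ N p ≠ 0 := by
  rw [hom_eq_X_pow_mul τ le_rfl hN]
  refine mul_ne_zero (pow_ne_zero _ X_ne_zero) fun h => ?_
  apply coeff_zero_hom_natDegree_ne τ hp
  rw [h, coeff_zero]

theorem hom_injective {N : ℕ} {p q : K[X]} (hp : 2 * p.natDegree ≤ N) (hq : 2 * q.natDegree ≤ N)
    (h : hom τ N p = hom τ N q) : p = q := by
  by_contra hne
  refine hom_ne_zero τ (N := N) (p := p - q) ?_ (sub_ne_zero.mpr hne) ?_
  · have := natDegree_sub_le p q
    omega
  · rw [hom_sub, h, sub_self]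

theorem natDegree_ram_le : (ram τ).natDegree ≤ 3 := by
  unfold ram; compute_degree

theorem coeff_ram : (ram τ).coeff 0 = -4 * τ - 27 * τ ^ 2 ∧ (ram τ).coeff 1 = 18 * τ ∧
    (ram τ).coeff 2 = 1 ∧ (ram τ).coeff 3 = -4 := by
  unfold ram
  refine ⟨?_, ?_, ?_, ?_⟩ <;>
  simp [coeff_X, coeff_C, -map_mul, -map_neg, -map_sub]

theorem hom_ram : hom τ 6 (ram τ) = fac τ ^ 2 * disc τ := by
  obtain ⟨h0, h1, h2, h3⟩ := coeff_ram τ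
  simp only [hom, Finset.sum_range_succ, Finset.range_zero, Finset.sum_empty, h0, h1, h2, h3, cub,
    fac, disc, map_mul, map_sub, map_neg, map_pow, map_ofNat, map_one]
  ring

theorem derivative_hom (M : ℕ) (p : K[X]) :
    X * derivative (hom τ (M + 2) p) =
      C (M + 2 : K) * hom τ (M + 2) p + hom τ M (derivative p) * fac τ := by
  have key : ∀ i, 2 * i ≤ M + 2 → X * derivative (C (p.coeff i) * cub τ ^ i * X ^ (M + 2 - 2 * i))
      = C (M + 2 : K) * (C (p.coeff i) * cub τ ^ i * X ^ (M + 2 - 2 * i)) +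
        C (p.coeff i) * (C (i : K) * cub τ ^ (i - 1)) * X ^ (M + 2 - 2 * i) * fac τ := by
    intro i hi
    obtain ⟨j, hj⟩ : ∃ j, M + 2 = 2 * i + j := ⟨_, (Nat.add_sub_cancel' hi).symm⟩
    have e1 : M + 2 - 2 * i = j := by omega
    have e2 : (M + 2 : K) = 2 * i + j := by exact_mod_cast congrArg (Nat.cast (R := K)) hj
    have hd : X * derivative (cub τ) = 2 * cub τ + fac τ := by
      simp only [cub, fac, derivative_add, derivative_sub, derivative_mul, derivative_C,
        derivative_X_pow, derivative_X, derivative_one]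
      simp only [Nat.cast_ofNat, map_ofNat]
      ring
    have hx : X * derivative (X ^ j : K[X]) = C (j : K) * X ^ j := by
      rw [derivative_X_pow]
      rcases j with _ | j
      · simp
      · rw [Nat.add_sub_cancel, pow_succ]; ring
    have hc : cub τ ^ (i - 1) * C (i : K) * cub τ = C (i : K) * cub τ ^ i := by
      rcases i with _ | i
      · simp
      · rw [Nat.add_sub_cancel, pow_succ]; ring
    rw [e1, e2, derivative_mul, derivative_mul, derivative_C, derivative_pow]
    simp only [map_add, map_mul, map_ofNat, C_eq_natCast] at hc hx ⊢
    linear_combination (C (p.coeff i) * i * cub τ ^ (i - 1) * X ^ j) * hd +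
      C (p.coeff i) * cub τ ^ i * hx + 2 * C (p.coeff i) * X ^ j * hc
  have hM : (M + 2) / 2 + 1 = M / 2 + 1 + 1 := by omega
  have h2 : hom τ M (derivative p) * fac τ = ∑ i ∈ Finset.range ((M + 2) / 2 + 1),
      C (p.coeff i) * (C (i : K) * cub τ ^ (i - 1)) * X ^ (M + 2 - 2 * i) * fac τ := by
    rw [hM, Finset.sum_range_succ', hom, Finset.sum_mul]
    simp only [Nat.cast_zero, map_zero, zero_mul, mul_zero, add_zero]
    refine Finset.sum_congr rfl fun i hi => ?_
    rw [coeff_derivative, Nat.add_sub_cancel, show M + 2 - 2 * (i + 1) = M - 2 * i by omega]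
    push_cast
    simp only [map_mul, map_add, map_one]
    ring
  rw [h2]
  conv_lhs => rw [hom, derivative_sum, Finset.mul_sum]
  conv_rhs => rw [hom, Finset.mul_sum, ← Finset.sum_add_distrib]
  refine Finset.sum_congr rfl fun i hi => key i ?_
  rw [Finset.mem_range] at hi
  omega

theorem isCoprime_hom {p q : K[X]} {d N : ℕ} (hd : p.natDegree ≤ d) (hN : 2 * q.natDegree ≤ N)
    (h0 : (hom τ (2 * d) p).coeff 0 ≠ 0) (h : IsCoprime p q) :
    IsCoprime (hom τ (2 * d) p) (hom τ N q) := by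
  obtain ⟨u, v, huv⟩ := h
  set a := 2 * u.natDegree
  set b := 2 * v.natDegree
  have hu : hom τ (2 * d + N + a + b) (u * p) = hom τ (a + b + N) u * hom τ (2 * d) p := by
    rw [← hom_mul τ (by omega) (by omega)]; congr 1; omega
  have hv : hom τ (2 * d + N + a + b) (v * q) = hom τ (a + b + 2 * d) v * hom τ N q := by
    rw [← hom_mul τ (by omega) (by omega)]; congr 1; omega
  have h1 := congrArg (hom τ (2 * d + N + a + b)) huv
  rw [hom_add, hom_one, hu, hv] at h1
  have hX : IsCoprime (hom τ (2 * d) p) (X ^ (2 * d + N + a + b)) := by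
    apply IsCoprime.pow_right
    rw [isCoprime_comm, (prime_X.irreducible).coprime_iff_not_dvd, X_dvd_iff]
    exact h0
  rw [← h1, add_comm, IsCoprime.add_mul_right_right_iff] at hX
  exact hX.of_mul_right_right

theorem isCoprime_hom_ram {q : K[X]} (hq : Irreducible q) (hE : ¬ q ∣ ram τ) :
    IsCoprime (hom τ (2 * q.natDegree) q) (fac τ) ∧
    IsCoprime (hom τ (2 * q.natDegree) q) (disc τ) := by
  have h := isCoprime_hom τ (N := 6) le_rfl (by have := natDegree_ram_le τ; omega)
    (coeff_zero_hom_natDegree_ne τ hq.ne_zero) (hq.coprime_iff_not_dvd.mpr hE)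
  rw [hom_ram, sq, mul_assoc] at h
  exact ⟨h.of_mul_right_left, h.of_mul_right_right.of_mul_right_right⟩

theorem squarefree_hom [CharZero K] {q : K[X]} (hq : Irreducible q) (hE : ¬ q ∣ ram τ) :
    Squarefree (hom τ (2 * q.natDegree) q) := by
  apply Separable.squarefree
  have hd : 0 < q.natDegree := hq.natDegree_pos
  obtain ⟨d, hd⟩ : ∃ d, q.natDegree = d + 1 := ⟨q.natDegree - 1, by omega⟩
  have h1 := (isCoprime_hom_ram τ hq hE).1
  have h2 := isCoprime_hom τ (N := 2 * d) le_rfl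
    (by have := natDegree_derivative_lt (p := q) (by omega); omega)
    (coeff_zero_hom_natDegree_ne τ hq.ne_zero) (hq.separable)
  have h3 := h2.mul_right h1
  have h4 := derivative_hom τ (2 * d) q
  rw [hd, show 2 * (d + 1) = 2 * d + 2 by ring] at h3 ⊢
  rw [← IsCoprime.add_mul_right_right_iff (z := C ((2 * d : ℕ) + 2 : K)),
    add_comm (hom τ (2 * d) (derivative q) * fac τ),
    ← h4] at h3
  exact h3.of_mul_right_right

theorem separable_ram [CharZero K] (h0 : τ ≠ 0) (h1 : 1 - 27 * τ ≠ 0) : (ram τ).Separable := by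
  have hD : -12 * τ * (1 - 27 * τ) ^ 3 ≠ 0 := by
    simp [h0, h1]
  have hu : C (-12 * τ * (1 - 27 * τ) ^ 3)⁻¹ * C (-12 * τ * (1 - 27 * τ) ^ 3) = (1 : K[X]) := by
    rw [← C_mul, inv_mul_cancel₀ hD, C_1]
  have hder : derivative (ram τ) = -12 * X ^ 2 + 2 * X + 18 * C τ := by
    simp only [ram, derivative_add, derivative_mul, derivative_C, derivative_X_pow, derivative_X,
      map_mul, map_neg, map_ofNat, Nat.cast_ofNat, derivative_ofNat]
    ring
  set a : K[X] := 1 + 216 * C τ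
  set l : K[X] := a * X + 9 * C τ * (7 + 54 * C τ) + 36 * C τ * a
  refine ⟨C (-12 * τ * (1 - 27 * τ) ^ 3)⁻¹ * (3 * a ^ 2 - 18 * l),
    C (-12 * τ * (1 - 27 * τ) ^ 3)⁻¹ * (-a ^ 2 * X - C (1 / 2) * l * (1 - 12 * X)), ?_⟩
  have h2 : C (1 / 2) * 2 = (1 : K[X]) := by
    rw [← map_ofNat C 2, ← C_mul]; simp
  refine Eq.trans ?_ hu
  rw [hder]
  generalize C (-12 * τ * (1 - 27 * τ) ^ 3)⁻¹ = c
  simp only [ram, l, a, map_mul, map_sub, map_neg, map_pow, map_ofNat, map_one]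
  linear_combination (-c * l * (1 - 12 * X) * (-6 * X ^ 2 + X + 9 * C τ)) * h2

end Hom
end Kreweras

namespace Kreweras
open PowerSeries

section Reduction

theorem eval_reflected {p : Polynomial ℂ} :
    (∑ j ∈ Finset.range (p.natDegree + 1), Polynomial.C (p.coeff j) * Polynomial.X ^ j *
      (Polynomial.X - 1) ^ (p.natDegree - j)).eval 1 = p.leadingCoeff := by
  rw [Polynomial.eval_finsetSum, Finset.sum_eq_single_of_mem p.natDegree (by simp)]
  · simp
  · intro j hj hne
    rw [Finset.mem_range] at hj
    have : p.natDegree - j ≠ 0 := by omega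
    simp [this]

theorem reduced_equation {σ0 : ℂ} (c : Curve σ0) (h2 : c.w2 = 0) {p q : Polynomial ℂ} {N : ℕ}
    {γ : ℂ} (h : c.w1 ^ N * c.σ (p : PowerSeries ℂ) = C γ * (p + q * c.w1)) :
    (Polynomial.X - 1) ^ N * (∑ j ∈ Finset.range (p.natDegree + 1), Polynomial.C (p.coeff j) *
      Polynomial.X ^ j * (Polynomial.X - 1) ^ (p.natDegree - j)) =
    Polynomial.C γ * (Polynomial.X - 1) ^ p.natDegree * (p + q * (Polynomial.X - 1)) := by
  have hw : c.w1 = ((Polynomial.X - 1 : Polynomial ℂ) : PowerSeries ℂ) := by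
    have := c.sum
    rw [h2, add_zero] at this
    rw [this, Polynomial.coe_sub]; simp
  have hs : c.w1 ^ p.natDegree * c.σ (p : PowerSeries ℂ) =
      ∑ j ∈ Finset.range (p.natDegree + 1), C (p.coeff j) * X ^ j *
      c.w1 ^ (p.natDegree - j) := by
    have h0 : (p : PowerSeries ℂ) = ((∑ j ∈ Finset.range (p.natDegree + 1),
        Polynomial.C (p.coeff j) * Polynomial.X ^ j : Polynomial ℂ) : PowerSeries ℂ) :=
      congrArg _ p.as_sum_range_C_mul_X_pow
    rw [h0, ← Polynomial.coeToPowerSeries.ringHom_apply, map_sum, map_sum, Finset.mul_sum]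
    refine Finset.sum_congr rfl fun j hj => ?_
    rw [Finset.mem_range] at hj
    obtain ⟨e, he⟩ : ∃ e, p.natDegree = e + j := ⟨p.natDegree - j, by omega⟩
    have h1 : c.w1 ^ j * c.i ^ j = 1 := by rw [← mul_pow, c.inv, one_pow]
    rw [Polynomial.coeToPowerSeries.ringHom_apply, Polynomial.coe_mul, Polynomial.coe_pow,
      Polynomial.coe_C, Polynomial.coe_X, map_mul, map_pow, c.σ_C, c.σ_X, he,
      Nat.add_sub_cancel, mul_pow, pow_add]
    linear_combination (c.w1 ^ e * C (p.coeff j) * X ^ j) * h1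
  apply Polynomial.coe_injective
  have e1 : ((∑ j ∈ Finset.range (p.natDegree + 1), Polynomial.C (p.coeff j) *
      Polynomial.X ^ j * (Polynomial.X - 1) ^ (p.natDegree - j) : Polynomial ℂ) : PowerSeries ℂ) =
      ∑ j ∈ Finset.range (p.natDegree + 1), C (p.coeff j) * X ^ j *
      c.w1 ^ (p.natDegree - j) := by
    rw [← Polynomial.coeToPowerSeries.ringHom_apply, map_sum]
    refine Finset.sum_congr rfl fun j hj => ?_
    rw [Polynomial.coeToPowerSeries.ringHom_apply, Polynomial.coe_mul, Polynomial.coe_mul,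
      Polynomial.coe_pow, Polynomial.coe_pow, Polynomial.coe_C, Polynomial.coe_X, hw]
  rw [Polynomial.coe_mul, Polynomial.coe_mul, Polynomial.coe_mul, Polynomial.coe_pow,
    Polynomial.coe_pow, Polynomial.coe_add, Polynomial.coe_mul, Polynomial.coe_C, ← hw, e1, ← hs]
  linear_combination (c.w1 ^ p.natDegree) * h

theorem reduced_vanish {p q : Polynomial ℂ} {N : ℕ} {γ : ℂ} (hγ : γ ≠ 0)
    (h : (Polynomial.X - 1) ^ N * (∑ j ∈ Finset.range (p.natDegree + 1), Polynomial.C (p.coeff j) *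
      Polynomial.X ^ j * (Polynomial.X - 1) ^ (p.natDegree - j)) =
    Polynomial.C γ * (Polynomial.X - 1) ^ p.natDegree * (p + q * (Polynomial.X - 1)))
    (hN : (N = 0 ∧ γ ≠ 1) ∨ (N = 0 ∧ p.coeff 0 = 0) ∨ (N = 1 ∧ γ = 1 ∧ p.coeff 1 = 0)) :
    p = 0 ∧ q = 0 := by
  have hX : (Polynomial.X - 1 : Polynomial ℂ) ≠ 0 := by
    simpa using Polynomial.X_sub_C_ne_zero (1 : ℂ)
  have hp : p = 0 := by
    by_contra hp
    have hl : p.leadingCoeff ≠ 0 := Polynomial.leadingCoeff_ne_zero.mpr hp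
    have hDN : p.natDegree ≤ N := by
      by_contra! hlt
      obtain ⟨e, he⟩ : ∃ e, p.natDegree = N + (e + 1) := ⟨p.natDegree - N - 1, by omega⟩
      have h1 : (∑ j ∈ Finset.range (p.natDegree + 1), Polynomial.C (p.coeff j) *
        Polynomial.X ^ j * (Polynomial.X - 1) ^ (p.natDegree - j)) =
        Polynomial.C γ * (Polynomial.X - 1) ^ (e + 1) * (p + q * (Polynomial.X - 1)) := by
        apply mul_left_cancel₀ (pow_ne_zero N hX)
        rw [h]
        conv_lhs => rw [he, pow_add]
        ring
      have h2 := congrArg (Polynomial.eval 1) h1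
      rw [eval_reflected] at h2
      exact hl (by simpa using h2)
    have hN1 : N ≤ 1 := by omega
    have h2 := congrArg (Polynomial.eval 1) h
    rw [Polynomial.eval_mul, eval_reflected] at h2
    interval_cases N
    · obtain ⟨a, ha⟩ := Polynomial.natDegree_eq_zero.mp (Nat.le_zero.mp hDN)
      subst ha
      simp at h2 hN hl
      rcases hN with h | h
      · have : (γ - 1) * a = 0 := by linear_combination -h2
        rcases mul_eq_zero.mp this with h' | h'
        · exact h (by linear_combination h')
        · exact hl h'
      · exact hl h
    · simp at hN
      obtain ⟨rfl, h1⟩ := hN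
      have hd : p.natDegree ≠ 1 := by
        intro hd; apply hl; rw [Polynomial.leadingCoeff, hd, h1]
      obtain ⟨a, ha⟩ := Polynomial.natDegree_eq_zero.mp (show p.natDegree = 0 by omega)
      subst ha
      simp at h2 hl
      exact hl h2.symm
  refine ⟨hp, ?_⟩
  subst hp
  simp [hγ, hX] at h
  tauto

end Reduction

variable {R : Type*} [CommRing R] {τ : R}

/-- A pair `(f, g)` of weight `N` and multiplier `γ`. -/
def IsInv (c : Curve τ) (N : ℕ) (γ : R) (f g : R⟦X⟧) : Prop :=
  c.w1 ^ N * c.σ g = C γ * f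

theorem IsInv.mul {c : Curve τ} {N M : ℕ} {γ δ : R} {f g f' g' : R⟦X⟧}
    (h : IsInv c N γ f g) (h' : IsInv c M δ f' g') :
    IsInv c (N + M) (γ * δ) (f * f') (g * g') := by
  unfold IsInv at *
  rw [map_mul, map_mul, pow_add]
  linear_combination (c.w1 ^ M * c.σ g') * h + C γ * f * h'

theorem IsInv.pow {c : Curve τ} {N : ℕ} {γ : R} {f g : R⟦X⟧} (h : IsInv c N γ f g) (m : ℕ) :
    IsInv c (m * N) (γ ^ m) (f ^ m) (g ^ m) := by
  induction m with
  | zero => simp [IsInv]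
  | succ m ih => rw [add_mul, one_mul, pow_succ, pow_succ, pow_succ]; exact ih.mul h

theorem IsInv.swap {c : Curve τ} {N : ℕ} {γ δ : R} {f g : R⟦X⟧} (h : IsInv c N γ f g)
    (hγ : δ * γ = 1) : IsInv c N δ g f := by
  unfold IsInv at *
  have h1 := congrArg c.σ h
  rw [map_mul, map_pow, c.σ_w1, c.σ_σ, map_mul, c.σ_C] at h1
  have h2 : c.w1 ^ N * c.i ^ N = 1 := by rw [← mul_pow, c.inv, one_pow]
  have h3 : C δ * C γ = (1 : R⟦X⟧) := by rw [← map_mul, hγ, map_one]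
  linear_combination (-c.w1 ^ N * C δ) * h1 + C δ * g * h2 - c.w1 ^ N * c.σ f * h3

theorem IsInv.C_mul {c : Curve τ} {N : ℕ} {γ : R} {f g : R⟦X⟧}
    (h : IsInv c N γ f g) (a : R) : IsInv c N γ (C a * f) (C a * g) := by
  unfold IsInv at *
  rw [map_mul, c.σ_C]
  linear_combination C a * h

theorem IsInv.sub {c : Curve τ} {N : ℕ} {γ : R} {f g f' g' : R⟦X⟧}
    (h : IsInv c N γ f g) (h' : IsInv c N γ f' g') : IsInv c N γ (f - f') (g - g') := by
  unfold IsInv at *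
  rw [map_sub]
  linear_combination h - h'

theorem isInv_X (c : Curve τ) : IsInv c 1 1 X X := by
  unfold IsInv
  rw [c.σ_X, map_one]
  linear_combination X * c.inv

theorem isInv_one (c : Curve τ) : IsInv c 0 1 1 1 := by simp [IsInv]

theorem IsInv.of_X_mul [IsDomain R] {c : Curve τ} {N : ℕ} {γ : R} {f g : R⟦X⟧}
    (h : IsInv c (N + 1) γ (X * f) (X * g)) : IsInv c N γ f g := by
  unfold IsInv at *
  apply mul_left_cancel₀ (X_ne_zero (R := R))
  rw [map_mul, c.σ_X] at h
  linear_combination h - c.w1 ^ N * X * c.σ g * c.inv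

variable (K : Type*) [Field K] [Algebra (PowerSeries ℂ) K] [IsFractionRing (PowerSeries ℂ) K]

/-- The parameter `t³`. -/
def tau : K := algebraMap (PowerSeries ℂ) K (X ^ 3)

/-- The curve with parameter `t³` over `ℂ⟦t⟧`. -/
def baseCurve : Curve (X ^ 3 : PowerSeries ℂ) := Classical.choice (nonempty_curve _)

/-- The curve with parameter `t³` over the field of fractions. -/
def cv : Curve (tau K) := baseCurve.map (algebraMap (PowerSeries ℂ) K)

variable {K}

theorem vanish {N : ℕ} {γ : ℂ} (hγ : γ ≠ 0) {a b : PowerSeries K} (ha : a ∈ TA K) (hb : b ∈ TA K)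
    (h : IsInv (cv K) N (algebraMap (PowerSeries ℂ) K (C γ)) (a + b * (cv K).w1)
      (a + b * (cv K).w2))
    (hN : (N = 0 ∧ γ ≠ 1) ∨ (N = 0 ∧ coeff 0 a = 0) ∨ (N = 1 ∧ γ = 1 ∧ coeff 1 a = 0)) :
    a = 0 ∧ b = 0 := by
  by_contra hab
  obtain ⟨u, α, β, hu, hα, hβ, h0⟩ := exists_normalized_pair ha hb (by tauto)
  have h := h.C_mul u
  rw [mul_add, mul_add, ← mul_assoc, ← mul_assoc, hα, hβ, IsInv] at h
  have h1 : baseCurve.w1 ^ N * baseCurve.σ (tr α + tr β * baseCurve.w2) =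
      C (C γ) * (tr α + tr β * baseCurve.w1) := by
    apply map_algebraMap_injective (K := K)
    rw [map_mul, map_mul, map_pow, Curve.map_σ, map_C]
    simp only [map_add, map_mul] at h ⊢
    exact h
  have h2 := congrArg (PowerSeries.map (constantCoeff (R := ℂ))) h1
  have hw2 : (baseCurve.map (constantCoeff (R := ℂ))).w2 = 0 := by
    have e := (baseCurve.map (constantCoeff (R := ℂ))).prod
    have e0 : C (constantCoeff (X ^ 3 : PowerSeries ℂ)) = (0 : PowerSeries ℂ) := by simp
    rw [e0, zero_mul, mul_eq_zero] at e
    refine e.resolve_left fun e1 => ?_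
    have := (baseCurve.map (constantCoeff (R := ℂ))).const
    rw [e1, map_zero] at this
    norm_num at this
  rw [map_mul, map_mul, map_pow, Curve.map_σ, map_C] at h2
  simp only [map_add, map_mul, map_constantCoeff_tr, constantCoeff_C,
    ← Curve.map_w1, ← Curve.map_w2, hw2, mul_zero, add_zero] at h2
  have h3 := reduced_equation _ hw2 h2
  have hc : ∀ n, coeff n a = 0 → (coeff 0 α).coeff n = 0 := by
    intro n hn
    have e := congrArg (coeff n) hα
    rw [coeff_C_mul, hn, mul_zero, trK_apply, coeff_map, eq_comm,
      IsFractionRing.to_map_eq_zero_iff] at e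
    rw [← coeff_tr, e, map_zero]
  have := reduced_vanish hγ h3 (by
    rcases hN with h | h | h
    · exact Or.inl h
    · exact Or.inr (Or.inl ⟨h.1, hc 0 h.2⟩)
    · exact Or.inr (Or.inr ⟨h.1, h.2.1, hc 1 h.2.2⟩))
  tauto

end Kreweras

namespace Kreweras
open PowerSeries

variable {K : Type*} [Field K] [Algebra (PowerSeries ℂ) K] [IsFractionRing (PowerSeries ℂ) K]

/-- Pairs of conjugate elements of the quadratic extension of `TA K`. -/
def InBB (f g : PowerSeries K) : Prop :=
  ∃ a ∈ TA K, ∃ b ∈ TA K, f = a + b * (cv K).w1 ∧ g = a + b * (cv K).w2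

theorem InBB.mul {f g f' g' : PowerSeries K} (h : InBB f g) (h' : InBB f' g') :
    InBB (f * f') (g * g') := by
  obtain ⟨a, ha, b, hb, rfl, rfl⟩ := h
  obtain ⟨c, hc, d, hd, rfl, rfl⟩ := h'
  have hX : (X - 1 : PowerSeries K) ∈ TA K := sub_mem X_mem_TA (one_mem _)
  have hT : (C (tau K) * X ^ 3 : PowerSeries K) ∈ TA K :=
    mul_mem (C_mem_TA _) (pow_mem X_mem_TA 3)
  refine ⟨a * c - b * d * (C (tau K) * X ^ 3),
    sub_mem (mul_mem ha hc) (mul_mem (mul_mem hb hd) hT),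
    a * d + b * c + b * d * (X - 1), add_mem (add_mem (mul_mem ha hd) (mul_mem hb hc))
      (mul_mem (mul_mem hb hd) hX), ?_, ?_⟩
  · have := (cv K).quad
    linear_combination (b * d) * this
  · have h1 := (cv K).sum
    have h2 := (cv K).prod
    linear_combination (b * d * (cv K).w2) * h1 - (b * d) * h2

theorem inBB_coe (P : Polynomial K) : InBB (P : PowerSeries K) P :=
  ⟨P, coe_mem_TA P, 0, zero_mem _, by simp, by simp⟩

theorem InBB.pow {f g : PowerSeries K} (h : InBB f g) (m : ℕ) : InBB (f ^ m) (g ^ m) := by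
  induction m with
  | zero => simpa using inBB_coe (K := K) 1
  | succ m ih => rw [pow_succ, pow_succ]; exact ih.mul h

theorem InBB.sub {f g f' g' : PowerSeries K} (h : InBB f g) (h' : InBB f' g') :
    InBB (f - f') (g - g') := by
  obtain ⟨a, ha, b, hb, rfl, rfl⟩ := h
  obtain ⟨c, hc, d, hd, rfl, rfl⟩ := h'
  exact ⟨a - c, sub_mem ha hc, b - d, sub_mem hb hd, by ring, by ring⟩

theorem InBB.swap {f g : PowerSeries K} (h : InBB f g) : InBB g f := by
  obtain ⟨a, ha, b, hb, rfl, rfl⟩ := h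
  have h1 := (cv K).sum
  exact ⟨a + b * (X - 1), add_mem ha (mul_mem hb (sub_mem X_mem_TA (one_mem _))), -b,
    neg_mem hb, by linear_combination b * h1, by linear_combination b * h1⟩

variable (K) in
/-- The anti-invariant of weight three. -/
def vv : PowerSeries K := (fac (tau K) : PowerSeries K) * ((cv K).w1 - (cv K).w2)

theorem coe_fac : (fac (tau K) : PowerSeries K) = 2 - X + C (tau K) * X ^ 3 := by
  rw [fac, Polynomial.coe_add, Polynomial.coe_sub, Polynomial.coe_mul, Polynomial.coe_pow,
    Polynomial.coe_C, Polynomial.coe_X, ← map_ofNat (Polynomial.C (R := K)) 2, Polynomial.coe_C,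
    map_ofNat]

theorem coe_cub : (cub (tau K) : PowerSeries K) = C (tau K) * X ^ 3 + X - 1 := by
  rw [cub, Polynomial.coe_sub, Polynomial.coe_add, Polynomial.coe_mul, Polynomial.coe_pow,
    Polynomial.coe_C, Polynomial.coe_X, Polynomial.coe_one]

theorem coe_disc : (disc (tau K) : PowerSeries K) = (X - 1) ^ 2 - 4 * C (tau K) * X ^ 3 := by
  rw [disc, Polynomial.coe_sub, Polynomial.coe_mul, Polynomial.coe_mul, Polynomial.coe_pow,
    Polynomial.coe_pow, Polynomial.coe_C, Polynomial.coe_sub, Polynomial.coe_X, Polynomial.coe_one,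
    ← map_ofNat (Polynomial.C (R := K)) 4, Polynomial.coe_C, map_ofNat]

theorem vv_eq : vv K = (2 - X + C (tau K) * X ^ 3) * ((cv K).w1 - (cv K).w2) := by
  rw [vv, coe_fac]

theorem vv_sq : vv K ^ 2 = (hom (tau K) 6 (ram (tau K)) : PowerSeries K) := by
  rw [hom_ram, Polynomial.coe_mul, Polynomial.coe_pow, coe_disc, vv, mul_pow]
  have h1 := (cv K).sum
  have h2 := (cv K).prod
  linear_combination ((fac (tau K) : PowerSeries K) ^ 2) *
    (((cv K).w1 + (cv K).w2 + (X - 1)) * h1 - 4 * h2)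

theorem constantCoeff_vv : constantCoeff (vv K) = -2 := by
  rw [vv_eq]
  simp [(cv K).const, (cv K).constantCoeff_w2]
  exact map_ofNat _ 2

theorem isInv_cub : IsInv (cv K) 2 1 (cub (tau K) : PowerSeries K) (cub (tau K)) := by
  have e : (cub (tau K) : PowerSeries K) = (cv K).w1 + (cv K).w2 + (cv K).w1 * (cv K).w2 := by
    rw [coe_cub, (cv K).sum, (cv K).prod]; ring
  rw [IsInv, e]
  simp only [map_add, map_mul, (cv K).σ_w1, (cv K).σ_w2, map_one]
  have := (cv K).inv
  linear_combination ((cv K).w1 + (cv K).w1 * (cv K).w2 +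
    (cv K).w2 * ((cv K).w1 * (cv K).i) + (cv K).w2) * this

theorem isInv_vv : IsInv (cv K) 3 1 (vv K) (-vv K) := by
  have e : vv K = (1 - (cv K).w1) * (1 - (cv K).w2) * ((cv K).w1 - (cv K).w2) := by
    rw [vv_eq]
    linear_combination ((cv K).w1 - (cv K).w2) * ((cv K).sum - (cv K).prod)
  rw [IsInv, map_neg, e]
  simp only [map_sub, map_mul, (cv K).σ_w1, (cv K).σ_w2, map_one]
  have h1 : (cv K).w1 * (1 - (cv K).i) = (cv K).w1 - 1 := by
    linear_combination -(cv K).inv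
  have h2 : (cv K).w1 * (1 - (cv K).w2 * (cv K).i) = (cv K).w1 - (cv K).w2 := by
    linear_combination -(cv K).w2 * (cv K).inv
  have h3 : (cv K).w1 * ((cv K).i - (cv K).w2 * (cv K).i) = 1 - (cv K).w2 := by
    linear_combination (1 - (cv K).w2) * (cv K).inv
  calc _ = -(((cv K).w1 * (1 - (cv K).i)) * ((cv K).w1 * (1 - (cv K).w2 * (cv K).i)) *
        ((cv K).w1 * ((cv K).i - (cv K).w2 * (cv K).i))) := by ring
    _ = _ := by rw [h1, h2, h3]; ring

theorem inBB_vv : InBB (vv K) (-vv K) := by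
  have h1 := (cv K).sum
  refine ⟨-(fac (tau K) * (Polynomial.X - 1) : Polynomial K), neg_mem (coe_mem_TA _),
    (2 * fac (tau K) : Polynomial K), coe_mem_TA _, ?_, ?_⟩ <;>
  · rw [Polynomial.coe_mul, Polynomial.coe_mul, Polynomial.coe_sub, Polynomial.coe_X,
      Polynomial.coe_one, ← map_ofNat (Polynomial.C (R := K)) 2, Polynomial.coe_C, map_ofNat, vv]
    linear_combination (-fac (tau K) : PowerSeries K) * h1

theorem coeff_zero_inBB {a b : PowerSeries K} :
    constantCoeff (a + b * (cv K).w1) = constantCoeff a - constantCoeff b ∧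
    constantCoeff (a + b * (cv K).w2) = constantCoeff a := by
  simp [(cv K).const, (cv K).constantCoeff_w2]
  ring

theorem exists_eq_X_mul {f g : PowerSeries K} (h : InBB f g) (hf : constantCoeff f = 0)
    (hg : constantCoeff g = 0) : ∃ f' g', InBB f' g' ∧ f = X * f' ∧ g = X * g' := by
  obtain ⟨a, ha, b, hb, rfl, rfl⟩ := h
  rw [coeff_zero_inBB.1] at hf
  rw [coeff_zero_inBB.2] at hg
  rw [hg, zero_sub, neg_eq_zero] at hf
  obtain ⟨a', rfl⟩ := X_dvd_iff.mpr hg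
  obtain ⟨b', rfl⟩ := X_dvd_iff.mpr hf
  exact ⟨_, _, ⟨a', mem_TA_of_X_mul ha, b', mem_TA_of_X_mul hb, rfl, rfl⟩, by ring, by ring⟩

theorem isInv_constantCoeff {N : ℕ} {f g : PowerSeries K} (h : IsInv (cv K) N 1 f g) :
    constantCoeff f = (-1) ^ N * constantCoeff g := by
  have := congrArg constantCoeff h
  rw [map_mul, map_pow, (cv K).const, (cv K).constantCoeff_σ] at this
  simpa using this.symm

/-- The form of an invariant pair of weight `N`. -/
def Repr (N : ℕ) (f g : PowerSeries K) : Prop :=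
  ∃ p r : Polynomial K, 2 * p.natDegree ≤ N ∧ (r = 0 ∨ 2 * r.natDegree + 3 ≤ N) ∧
    f = (hom (tau K) N p : PowerSeries K) + vv K * (hom (tau K) (N - 3) r : PowerSeries K) ∧
    g = (hom (tau K) N p : PowerSeries K) - vv K * (hom (tau K) (N - 3) r : PowerSeries K)

theorem coe_C_mul_hom (N : ℕ) (c : K) (p : Polynomial K) :
    (hom (tau K) N (Polynomial.C c * p) : PowerSeries K) = C c * (hom (tau K) N p : PowerSeries K) := by
  rw [hom_C_mul, Polynomial.coe_mul, Polynomial.coe_C]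

theorem Repr.X_mul {N : ℕ} {f g : PowerSeries K} (h : Repr N f g) :
    Repr (N + 1) (X * f) (X * g) := by
  obtain ⟨p, r, hp, hr, rfl, rfl⟩ := h
  have h1 : (hom (tau K) (N + 1) p : PowerSeries K) = X * (hom (tau K) N p : PowerSeries K) := by
    have := hom_mul (tau K) (N := 1) (p := 1) (M := N) (by simp) hp
    rw [hom_one, pow_one, one_mul, add_comm] at this
    rw [this, Polynomial.coe_mul, Polynomial.coe_X]
  have h2 : (hom (tau K) (N + 1 - 3) r : PowerSeries K) =
      X * (hom (tau K) (N - 3) r : PowerSeries K) := by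
    rcases hr with rfl | hr
    · simp [hom_zero]
    · have := hom_mul (tau K) (N := 1) (p := 1) (M := N - 3) (q := r) (by simp) (by omega)
      rw [hom_one, pow_one, one_mul, show 1 + (N - 3) = N + 1 - 3 by omega] at this
      rw [this, Polynomial.coe_mul, Polynomial.coe_X]
  refine ⟨p, r, by omega, ?_, ?_, ?_⟩
  · rcases hr with hr | hr
    · exact Or.inl hr
    · exact Or.inr (by omega)
  · rw [h1, h2]; ring
  · rw [h1, h2]; ring

theorem Repr.add {N : ℕ} {f g f' g' : PowerSeries K} (h : Repr N f g) (h' : Repr N f' g') :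
    Repr N (f + f') (g + g') := by
  obtain ⟨p, r, hp, hr, rfl, rfl⟩ := h
  obtain ⟨p', r', hp', hr', rfl, rfl⟩ := h'
  refine ⟨p + p', r + r', ?_, ?_, ?_, ?_⟩
  · have := Polynomial.natDegree_add_le p p'; omega
  · rcases hr with rfl | hr
    · simpa using hr'
    · rcases hr' with rfl | hr'
      · simpa using Or.inr hr
      · have := Polynomial.natDegree_add_le r r'; omega
  · rw [hom_add, hom_add, Polynomial.coe_add, Polynomial.coe_add]; ring
  · rw [hom_add, hom_add, Polynomial.coe_add, Polynomial.coe_add]; ring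

theorem hom_X_pow (i : ℕ) : hom (tau K) (2 * i) (Polynomial.X ^ i) = cub (tau K) ^ i := by
  rw [mul_comm, hom_pow _ (by simp)]
  congr 1
  simp [hom, Finset.sum_range_succ]

theorem repr_cub (c : K) (i : ℕ) :
    Repr (2 * i) (C c * (cub (tau K) : PowerSeries K) ^ i)
      (C c * (cub (tau K) : PowerSeries K) ^ i) := by
  refine ⟨Polynomial.C c * Polynomial.X ^ i, 0, ?_, Or.inl rfl, ?_, ?_⟩
  · have := Polynomial.natDegree_C_mul_X_pow_le c i; omega
  all_goals rw [coe_C_mul_hom, hom_X_pow, hom_zero, Polynomial.coe_pow]; simp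

theorem repr_vv (c : K) (i : ℕ) :
    Repr (2 * i + 3) (C c * (cub (tau K) : PowerSeries K) ^ i * vv K)
      (C c * (cub (tau K) : PowerSeries K) ^ i * -vv K) := by
  refine ⟨0, Polynomial.C c * Polynomial.X ^ i, by simp, Or.inr ?_, ?_, ?_⟩
  · have := Polynomial.natDegree_C_mul_X_pow_le c i; omega
  all_goals
    rw [Nat.add_sub_cancel, coe_C_mul_hom, hom_X_pow, hom_zero, Polynomial.coe_pow]; simp; ring

theorem repr_of_isInv [CharZero K] (N : ℕ) {f g : PowerSeries K} (hB : InBB f g)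
    (h : IsInv (cv K) N 1 f g) : Repr N f g := by
  have h1C : (1 : K) = algebraMap (PowerSeries ℂ) K (C 1) := by simp
  induction N using Nat.strong_induction_on generalizing f g with
  | _ N ih =>
  obtain rfl | rfl | ⟨n, rfl⟩ : N = 0 ∨ N = 1 ∨ ∃ n, N = n + 2 := by
    rcases N with _ | _ | n
    · exact Or.inl rfl
    · exact Or.inr (Or.inl rfl)
    · exact Or.inr (Or.inr ⟨n, rfl⟩)
  · obtain ⟨a, ha, b, hb, rfl, rfl⟩ := hB
    have h2 := h.sub ((isInv_one (cv K)).C_mul (constantCoeff a))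
    rw [h1C, mul_one, add_sub_right_comm, add_sub_right_comm] at h2
    obtain ⟨h3, h4⟩ := vanish one_ne_zero (sub_mem ha (C_mem_TA _)) hb h2 (by simp)
    rw [sub_eq_zero] at h3
    have := repr_cub (constantCoeff a) 0
    rw [h4, h3]
    simpa using this
  · obtain ⟨a, ha, b, hb, rfl, rfl⟩ := hB
    have h2 := h.sub ((isInv_X (cv K)).C_mul (coeff 1 a))
    rw [h1C, add_sub_right_comm, add_sub_right_comm] at h2
    obtain ⟨h3, h4⟩ := vanish one_ne_zero (sub_mem ha (mul_mem (C_mem_TA _) X_mem_TA)) hb h2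
      (by simp)
    rw [sub_eq_zero] at h3
    have := (repr_cub (coeff 1 a) 0).X_mul
    rw [h4, h3]
    simpa [mul_comm X] using this
  · have step : ∀ f1 g1, Repr (n + 2) f1 g1 → InBB f1 g1 → IsInv (cv K) (n + 2) 1 f1 g1 →
        constantCoeff f = constantCoeff f1 → constantCoeff g = constantCoeff g1 →
        Repr (n + 2) f g := by
      intro f1 g1 hr1 hb1 hi1 hf hg
      obtain ⟨f', g', hb', e1, e2⟩ := exists_eq_X_mul (hB.sub hb1) (by simp [hf]) (by simp [hg])
      have h3 := h.sub hi1
      rw [e1, e2] at h3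
      have h4 := ((ih (n + 1) (by omega) hb' h3.of_X_mul).X_mul).add hr1
      rwa [← e1, ← e2, sub_add_cancel, sub_add_cancel] at h4
    have h0 := isInv_constantCoeff h
    have hc0 : constantCoeff (cub (tau K) : PowerSeries K) = -1 := by rw [coe_cub]; simp
    rcases Nat.even_or_odd' (n + 2) with ⟨i, hi | hi⟩
    · have hsq : ((-1 : K) ^ i) * (-1) ^ i = 1 := by rw [← mul_pow]; simp
      have hev : (-1 : K) ^ (n + 2) = 1 := by rw [hi, pow_mul]; simp
      rw [hev, one_mul] at h0
      refine step _ _ (hi ▸ repr_cub (constantCoeff f * (-1) ^ i) i) ?_ ?_ ?_ ?_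
      · have := inBB_coe (Polynomial.C (constantCoeff f * (-1) ^ i) * cub (tau K) ^ i)
        rwa [Polynomial.coe_mul, Polynomial.coe_pow, Polynomial.coe_C] at this
      · have := (isInv_cub (K := K)).pow i
        rw [one_pow, mul_comm i 2, ← hi] at this
        exact this.C_mul _
      · rw [map_mul, map_pow, hc0, constantCoeff_C]
        linear_combination -constantCoeff f * hsq
      · rw [map_mul, map_pow, hc0, constantCoeff_C, ← h0]
        linear_combination -constantCoeff f * hsq
    · obtain ⟨j, rfl⟩ : ∃ j, i = j + 1 := ⟨i - 1, by omega⟩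
      have hi' : n + 2 = 2 * j + 3 := by omega
      have hsq : ((-1 : K) ^ j) * (-1) ^ j = 1 := by rw [← mul_pow]; simp
      have hev : (-1 : K) ^ (n + 2) = -1 := by rw [hi, pow_succ, pow_mul]; simp
      rw [hev] at h0
      set κ := constantCoeff f * (-1) ^ j * (-1 / 2)
      refine step _ _ (hi' ▸ repr_vv κ j) ?_ ?_ ?_ ?_
      · have := (inBB_coe (Polynomial.C κ * cub (tau K) ^ j)).mul inBB_vv
        rwa [Polynomial.coe_mul, Polynomial.coe_pow, Polynomial.coe_C] at this
      · have := ((((isInv_cub (K := K)).pow j).C_mul κ)).mul isInv_vv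
        rw [one_pow, mul_comm j 2, one_mul, ← hi'] at this
        exact this
      · rw [map_mul, map_mul, map_pow, hc0, constantCoeff_C, constantCoeff_vv]
        simp only [κ]
        linear_combination -constantCoeff f * hsq
      · rw [map_mul, map_mul, map_pow, hc0, constantCoeff_C, map_neg, constantCoeff_vv]
        simp only [κ]
        linear_combination constantCoeff f * hsq + h0

end Kreweras

namespace Kreweras
open PowerSeries

variable {K : Type*} [Field K] [Algebra (PowerSeries ℂ) K] [IsFractionRing (PowerSeries ℂ) K]

/-- A polynomial as an element of `TA K`. -/
def toTA (P : Polynomial K) : TA K := ⟨P, coe_mem_TA P⟩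

theorem toTA_mul (P Q : Polynomial K) : toTA (P * Q) = toTA P * toTA Q :=
  Subtype.ext (Polynomial.coe_mul P Q)

theorem toTA_add (P Q : Polynomial K) : toTA (P + Q) = toTA P + toTA Q :=
  Subtype.ext (Polynomial.coe_add P Q)

theorem toTA_pow (P : Polynomial K) (n : ℕ) : toTA (P ^ n) = toTA P ^ n :=
  Subtype.ext (Polynomial.coe_pow n)

theorem toTA_dvd_of_dvd_pow {Q : Polynomial K} (hQ : Squarefree Q) (hQ0 : Q ≠ 0) {x : TA K} {n : ℕ}
    (hn : n ≠ 0) (h : toTA Q ∣ x ^ n) : toTA Q ∣ x := by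
  obtain ⟨P, e, he, hx⟩ := exists_polynomial_add_mul (coe_mem_TA Q)
    (fun h => hQ0 (Polynomial.coe_eq_zero_iff.mp h)) x.2
  have hx : x = toTA P + toTA Q * ⟨e, he⟩ := Subtype.ext hx
  have h1 : toTA Q ∣ toTA (P ^ n) := by
    have := sub_dvd_pow_sub_pow x (toTA P) n
    rw [toTA_pow]
    refine (dvd_sub_right h).mp (dvd_trans ?_ this)
    rw [hx, add_sub_cancel_left]
    exact dvd_mul_right _ _
  let J : Ideal (Polynomial K) :=
    { carrier := {P | toTA Q ∣ toTA P}
      add_mem' := fun {a b} ha hb => by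
        simp only [Set.mem_ofPred_eq, toTA_add] at *; exact dvd_add ha hb
      zero_mem' := by
        have : toTA (0 : Polynomial K) = 0 := Subtype.ext Polynomial.coe_zero
        simp [this]
      smul_mem' := fun c a ha => by
        simp only [Set.mem_ofPred_eq, smul_eq_mul, toTA_mul] at *; exact ha.mul_left _ }
  obtain ⟨g, hg⟩ := IsPrincipalIdealRing.principal J
  have hJ : ∀ P, P ∈ J ↔ g ∣ P := fun P => by rw [hg]; exact Ideal.mem_span_singleton
  have hgQ : g ∣ Q := (hJ Q).mp (dvd_refl (toTA Q))
  have hgP : g ∣ P := ((hQ.squarefree_of_dvd hgQ).dvd_pow_iff_dvd hn).mp ((hJ _).mp h1)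
  have : toTA Q ∣ toTA P := (hJ P).mpr hgP
  rw [hx]
  exact dvd_add this (dvd_mul_right _ _)


theorem w1_ne_w2 : (cv K).w1 - (cv K).w2 ≠ 0 := by
  intro h
  have := congrArg constantCoeff h
  rw [map_sub, (cv K).const, (cv K).constantCoeff_w2] at this
  simp at this

theorem InBB.trace_mem {f g : PowerSeries K} (h : InBB f g) : f + g ∈ TA K := by
  obtain ⟨a, ha, b, hb, rfl, rfl⟩ := h
  have e : a + b * (cv K).w1 + (a + b * (cv K).w2) = a + a + b * (X - 1) := by
    linear_combination b * (cv K).sum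
  rw [e]
  exact add_mem (add_mem ha ha) (mul_mem hb (sub_mem X_mem_TA (one_mem _)))

theorem InBB.norm_mem {f g : PowerSeries K} (h : InBB f g) : f * g ∈ TA K := by
  obtain ⟨a, ha, b, hb, rfl, rfl⟩ := h
  have e : (a + b * (cv K).w1) * (a + b * (cv K).w2) =
      a * a + a * b * (X - 1) + b * b * (C (tau K) * X ^ 3) := by
    linear_combination a * b * (cv K).sum + b * b * (cv K).prod
  rw [e]
  exact add_mem (add_mem (mul_mem ha ha)
    (mul_mem (mul_mem ha hb) (sub_mem X_mem_TA (one_mem _))))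
    (mul_mem (mul_mem hb hb) (mul_mem (C_mem_TA _) (pow_mem X_mem_TA 3)))

theorem exists_mul_add_pow {f g : PowerSeries K} (h : InBB f g) (n : ℕ) :
    ∃ y ∈ TA K, (f + g) ^ (n + 1) = f ^ (n + 1) + g ^ (n + 1) + f * g * y := by
  induction n with
  | zero => exact ⟨0, zero_mem _, by ring⟩
  | succ n ih =>
    obtain ⟨y, hy, e⟩ := ih
    refine ⟨f ^ n + g ^ n + (f + g) * y, add_mem (h.pow n).trace_mem
      (mul_mem h.trace_mem hy), ?_⟩
    rw [pow_succ, e]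
    ring

/-- A common factor of the powers divides the pair. -/
theorem exists_eq_mul_of_pow_eq [CharZero K] {Q : Polynomial K} (hQ : Squarefree Q) (hQ0 : Q ≠ 0)
    (hd : IsCoprime Q (disc (tau K))) {f g : PowerSeries K} (h : InBB f g) {n : ℕ} (hn : n ≠ 0)
    {f' g' : PowerSeries K} (h' : InBB f' g') (hf : f ^ n = (Q : PowerSeries K) * f') (hg : g ^ n = (Q : PowerSeries K) * g') :
    ∃ f'' g'', InBB f'' g'' ∧ f = (Q : PowerSeries K) * f'' ∧ g = (Q : PowerSeries K) * g'' := by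
  obtain ⟨n, rfl⟩ := Nat.exists_eq_succ_of_ne_zero hn
  have h1 : toTA Q ∣ (⟨f * g, h.norm_mem⟩ : TA K) := by
    refine toTA_dvd_of_dvd_pow hQ hQ0 hn ⟨toTA Q * ⟨_, h'.norm_mem⟩, Subtype.ext ?_⟩
    change (f * g) ^ (n + 1) = Q * (Q * (f' * g'))
    rw [mul_pow, hf, hg]; ring
  have h2 : toTA Q ∣ (⟨f + g, h.trace_mem⟩ : TA K) := by
    obtain ⟨y, hy, e⟩ := exists_mul_add_pow h n
    have e' : (⟨f + g, h.trace_mem⟩ : TA K) ^ (n + 1) =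
        toTA Q * ⟨_, h'.trace_mem⟩ + ⟨f * g, h.norm_mem⟩ * ⟨y, hy⟩ := by
      refine Subtype.ext ?_
      change (f + g) ^ (n + 1) = Q * (f' + g') + f * g * y
      rw [e, hf, hg]; ring
    refine toTA_dvd_of_dvd_pow hQ hQ0 hn ?_
    rw [e']
    exact dvd_add (dvd_mul_right _ _) (h1.mul_right _)
  obtain ⟨a, ha, b, hb, rfl, rfl⟩ := h
  obtain ⟨u, v, huv⟩ := hd
  have h3 : toTA Q ∣ (⟨b, hb⟩ : TA K) := by
    refine toTA_dvd_of_dvd_pow hQ hQ0 two_ne_zero ?_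
    have e' : (⟨b, hb⟩ : TA K) ^ 2 = toTA Q * (toTA u * ⟨b, hb⟩ ^ 2) + toTA v *
        (⟨_, InBB.trace_mem ⟨a, ha, b, hb, rfl, rfl⟩⟩ ^ 2 -
          4 * ⟨_, InBB.norm_mem ⟨a, ha, b, hb, rfl, rfl⟩⟩) := by
      refine Subtype.ext ?_
      change b ^ 2 = Q * (u * b ^ 2) + v * ((a + b * (cv K).w1 + (a + b * (cv K).w2)) ^ 2 -
        4 * ((a + b * (cv K).w1) * (a + b * (cv K).w2)))
      have := congrArg (Polynomial.toPowerSeries) huv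
      rw [Polynomial.coe_add, Polynomial.coe_mul, Polynomial.coe_mul, coe_disc,
        Polynomial.coe_one] at this
      linear_combination (-b ^ 2) * this - v * b ^ 2 * (((cv K).w1 + (cv K).w2 + (X - 1)) *
        (cv K).sum - 4 * (cv K).prod)
    rw [e']
    refine dvd_add (dvd_mul_right _ _) (Dvd.dvd.mul_left (dvd_sub ?_ ?_) _)
    · exact dvd_pow h2 two_ne_zero
    · exact h1.mul_left _
  have h4 : toTA Q ∣ (⟨a, ha⟩ : TA K) := by
    have e' : (⟨a, ha⟩ : TA K) = ⟨C 2⁻¹, C_mem_TA _⟩ *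
        (⟨_, InBB.trace_mem ⟨a, ha, b, hb, rfl, rfl⟩⟩ -
          ⟨b, hb⟩ * ⟨X - 1, sub_mem X_mem_TA (one_mem _)⟩) := by
      refine Subtype.ext ?_
      change a = C 2⁻¹ * ((a + b * (cv K).w1 + (a + b * (cv K).w2)) - b * (X - 1))
      have h2 : C (2⁻¹ : K) * 2 = (1 : PowerSeries K) := by
        rw [← map_ofNat (C (R := K)) 2, ← map_mul, inv_mul_cancel₀ two_ne_zero, map_one]
      linear_combination -a * h2 - C 2⁻¹ * b * (cv K).sum
    rw [e']
    exact (dvd_sub h2 (h3.mul_right _)).mul_left _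
  obtain ⟨⟨c, hc⟩, e1⟩ := h3
  obtain ⟨⟨d, hd⟩, e2⟩ := h4
  have e1 : b = Q * c := congrArg Subtype.val e1
  have e2 : a = Q * d := congrArg Subtype.val e2
  exact ⟨_, _, ⟨d, hd, c, hc, rfl, rfl⟩, by rw [e1, e2]; ring, by rw [e1, e2]; ring⟩

theorem isInv_hom {N : ℕ} (p : Polynomial K) :
    IsInv (cv K) N 1 (hom (tau K) N p : PowerSeries K) (hom (tau K) N p) := by
  rw [hom, ← Polynomial.coeToPowerSeries.ringHom_apply, map_sum]
  have h : ∀ (s : Finset ℕ) (F : ℕ → PowerSeries K), (∀ i ∈ s, IsInv (cv K) N 1 (F i) (F i)) →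
      IsInv (cv K) N 1 (∑ i ∈ s, F i) (∑ i ∈ s, F i) := by
    intro s F hF
    simp only [IsInv, map_sum, Finset.mul_sum] at *
    exact Finset.sum_congr rfl hF
  refine h _ _ fun i hi => ?_
  rw [Finset.mem_range] at hi
  have := (((isInv_cub (K := K)).pow i).C_mul (p.coeff i)).mul ((isInv_X (cv K)).pow (N - 2 * i))
  rw [one_pow, one_pow, mul_one, mul_one, show i * 2 + (N - 2 * i) = N by omega] at this
  rw [Polynomial.coeToPowerSeries.ringHom_apply, Polynomial.coe_mul, Polynomial.coe_mul,
    Polynomial.coe_pow, Polynomial.coe_pow, Polynomial.coe_C, Polynomial.coe_X]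
  exact this

theorem IsInv.of_hom_mul {d : ℕ} {q : Polynomial K} (hd : 1 ≤ d) (hq : hom (tau K) (2 * d) q ≠ 0)
    {γ : K} {f g : PowerSeries K}
    (h : IsInv (cv K) 2 γ (hom (tau K) (2 * d) q * f) (hom (tau K) (2 * d) q * g)) :
    IsInv (cv K) 0 γ (X ^ (2 * d - 2) * f) (X ^ (2 * d - 2) * g) := by
  have h1 := isInv_hom (N := 2 * d) q
  have hq' : (hom (tau K) (2 * d) q : PowerSeries K) ≠ 0 :=
    fun h => hq (Polynomial.coe_eq_zero_iff.mp h)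
  obtain ⟨e, rfl⟩ : ∃ e, d = e + 1 := ⟨d - 1, by omega⟩
  unfold IsInv at *
  have h2 : (cv K).w1 ^ (2 * e) * (cv K).i ^ (2 * e) = 1 := by
    rw [← mul_pow, (cv K).inv, one_pow]
  rw [show 2 * (e + 1) - 2 = 2 * e by omega, map_mul, map_pow, (cv K).σ_X, mul_pow]
  rw [map_mul] at h
  rw [map_one, one_mul, show 2 * (e + 1) = 2 * e + 2 by ring, pow_add] at h1
  rw [show 2 * (e + 1) = 2 * e + 2 by ring] at h hq'
  apply mul_left_cancel₀ hq'
  linear_combination (-X ^ (2 * e) * (cv K).i ^ (2 * e) * (cv K).σ g) * h1 +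
    (X ^ (2 * e) * (cv K).i ^ (2 * e) * (cv K).w1 ^ (2 * e)) * h +
    (C γ * X ^ (2 * e) * hom (tau K) (2 * e + 2) q * f) * h2

theorem hom_mul_left {N d : ℕ} {q p : Polynomial K} (hq : q ≠ 0) (hd : q.natDegree = d)
    (hp : 2 * p.natDegree ≤ N) (h : q ∣ p) :
    ∃ p' : Polynomial K, hom (tau K) N p = hom (tau K) (2 * d) q * p' := by
  subst hd
  obtain ⟨u, rfl⟩ := h
  rcases eq_or_ne u 0 with rfl | hu
  · exact ⟨0, by simp [hom_zero]⟩
  · rw [Polynomial.natDegree_mul hq hu] at hp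
    refine ⟨hom (tau K) (N - 2 * q.natDegree) u, ?_⟩
    rw [← hom_mul _ le_rfl (by omega)]
    congr 1
    omega

theorem not_dvd_of_isInv [CharZero K] {f g : PowerSeries K} (hB : InBB f g) {γ : ℂ} (hγ : γ ≠ 0)
    (hγ1 : γ ≠ 1) (h : IsInv (cv K) 2 (algebraMap (PowerSeries ℂ) K (C γ)) f g) (hf : f ≠ 0)
    {m : ℕ} (hm : m ≠ 0) {p r q : Polynomial K} (hp : 2 * p.natDegree ≤ 2 * m)
    (hr : r = 0 ∨ 2 * r.natDegree + 3 ≤ 2 * m)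
    (hfm : f ^ m = (hom (tau K) (2 * m) p : PowerSeries K) +
      vv K * (hom (tau K) (2 * m - 3) r : PowerSeries K))
    (hgm : g ^ m = (hom (tau K) (2 * m) p : PowerSeries K) -
      vv K * (hom (tau K) (2 * m - 3) r : PowerSeries K))
    (hq : Irreducible q) (hqE : ¬ q ∣ ram (tau K)) (hqp : q ∣ p) : ¬ q ∣ r := by
  intro hqr
  obtain ⟨p', hp'⟩ := hom_mul_left hq.ne_zero rfl hp hqp
  obtain ⟨r', hr'⟩ : ∃ r', hom (tau K) (2 * m - 3) r = hom (tau K) (2 * q.natDegree) q * r' := by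
    rcases hr with rfl | hr
    · exact ⟨0, by simp [hom_zero]⟩
    · exact hom_mul_left hq.ne_zero rfl (by omega) hqr
  set Q := hom (tau K) (2 * q.natDegree) q with hQ
  have hQ0 : Q ≠ 0 := hom_ne_zero _ le_rfl hq.ne_zero
  have hB' : InBB ((p' : PowerSeries K) - -vv K * (r' : PowerSeries K)) (p' - vv K * (r' : PowerSeries K)) :=
    (inBB_coe p').sub (inBB_vv.swap.mul (inBB_coe r'))
  obtain ⟨f'', g'', hB'', rfl, rfl⟩ := exists_eq_mul_of_pow_eq (squarefree_hom _ hq hqE) hQ0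
    (isCoprime_hom_ram _ hq hqE).2 hB hm hB'
    (by rw [hfm, hp', hr', Polynomial.coe_mul, Polynomial.coe_mul]; ring)
    (by rw [hgm, hp', hr', Polynomial.coe_mul, Polynomial.coe_mul]; ring)
  have h5 := IsInv.of_hom_mul hq.natDegree_pos hQ0 h
  have hB5 := (inBB_coe (Polynomial.X ^ (2 * q.natDegree - 2) : Polynomial K)).mul hB''
  rw [Polynomial.coe_pow, Polynomial.coe_X] at hB5
  obtain ⟨a, ha, b, hb, e1, e2⟩ := hB5
  rw [e1, e2] at h5
  obtain ⟨rfl, rfl⟩ := vanish hγ ha hb h5 (Or.inl ⟨rfl, hγ1⟩)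
  rw [zero_mul, add_zero, mul_eq_zero] at e1
  rcases e1 with e1 | e1
  · exact pow_ne_zero _ X_ne_zero e1
  · exact hf (by rw [e1, mul_zero])

end Kreweras

namespace Kreweras

section UFD

variable {R : Type*} [CommRing R] [IsDomain R] [UniqueFactorizationMonoid R]

theorem dvd_of_forall_prime_pow_dvd {a b : R} (ha : a ≠ 0)
    (h : ∀ q, Prime q → ∀ k, q ^ k ∣ a → q ^ k ∣ b) : a ∣ b := by
  rw [UniqueFactorizationMonoid.dvd_iff_emultiplicity_le ha]
  intro q hq
  refine ENat.forall_natCast_le_iff_le.mp fun k hk => ?_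
  rw [← pow_dvd_iff_le_emultiplicity] at *
  exact h q hq k hk

omit [UniqueFactorizationMonoid R] in
theorem exists_pow_dvd_of_pow_dvd {q e : R} (hq : Prime q) (he : ¬ q ∣ e) (k : ℕ) :
    ∀ p r : R, q ^ k ∣ p ^ 2 - q * e * r ^ 2 → ∃ i j, k ≤ i + j ∧ q ^ i ∣ p ∧ q ^ j ∣ r := by
  have h1 : ∀ p r : R, q ∣ p ^ 2 - q * e * r ^ 2 → q ∣ p := fun p r h => by
    refine hq.dvd_of_dvd_pow (n := 2) ((dvd_sub_left ?_).mp h)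
    rw [mul_assoc]; exact dvd_mul_right _ _
  induction k using Nat.strong_induction_on with
  | _ k ih =>
  intro p r h
  obtain rfl | rfl | ⟨l, rfl⟩ : k = 0 ∨ k = 1 ∨ ∃ l, k = l + 2 := by
    rcases k with _ | _ | n
    · exact Or.inl rfl
    · exact Or.inr (Or.inl rfl)
    · exact Or.inr (Or.inr ⟨n, rfl⟩)
  · exact ⟨0, 0, by simp, by simp, by simp⟩
  · exact ⟨1, 0, by simp, by simpa using h1 p r (by simpa using h), by simp⟩
  · obtain ⟨p, rfl⟩ := h1 p r (dvd_trans (dvd_pow_self _ (by omega)) h)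
    have h2 : q ^ (l + 1) ∣ q * p ^ 2 - e * r ^ 2 := by
      rw [← mul_dvd_mul_iff_left hq.ne_zero]
      convert h using 1 <;> ring
    have h3 : q ∣ r := by
      have h4 : q ∣ e * r ^ 2 :=
        (dvd_sub_right (dvd_mul_right _ _)).mp (dvd_trans (dvd_pow_self _ (by omega)) h2)
      exact hq.dvd_of_dvd_pow ((hq.dvd_or_dvd h4).resolve_left he)
    obtain ⟨r, rfl⟩ := h3
    have h5 : q ^ l ∣ p ^ 2 - q * e * r ^ 2 := by
      rw [← mul_dvd_mul_iff_left hq.ne_zero]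
      convert h2 using 1 <;> ring
    obtain ⟨i, j, hij, hi, hj⟩ := ih l (by omega) p r h5
    exact ⟨i + 1, j + 1, by omega, by rw [pow_succ']; exact mul_dvd_mul_left _ hi,
      by rw [pow_succ']; exact mul_dvd_mul_left _ hj⟩

variable (D : Derivation ℤ R R)

omit [IsDomain R] [UniqueFactorizationMonoid R] in
theorem pow_dvd_derivation {q : R} (hD : q ∣ D q) {k : ℕ} {a : R} (h : q ^ k ∣ a) :
    q ^ k ∣ D a := by
  obtain ⟨u, rfl⟩ := h
  obtain ⟨v, hv⟩ := hD
  rcases k with _ | k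
  · simp
  · rw [D.leibniz, D.leibniz_pow, hv]
    refine ⟨D u + u * (k + 1) * v, ?_⟩
    simp only [smul_eq_mul, nsmul_eq_mul, Nat.add_sub_cancel]
    push_cast
    ring

omit [UniqueFactorizationMonoid R] in
theorem dvd_derivation_of_dvd {E q : R} (hE : Squarefree E) (hDE : D E = 0) (hq : Prime q)
    (h : q ∣ E) : q ∣ D q := by
  obtain ⟨e, rfl⟩ := h
  have he : ¬ q ∣ e := by
    rintro ⟨u, rfl⟩
    exact hq.not_isUnit (hE q ⟨u, by ring⟩)
  rw [D.leibniz, smul_eq_mul, smul_eq_mul] at hDE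
  have : q ∣ e * D q := ⟨-D e, by linear_combination hDE⟩
  exact (hq.dvd_or_dvd this).resolve_left he

variable {E p r n : R} {m : ℕ} (hE : Squarefree E) (hDE : D E = 0) (hm : m ≠ 0)
  (h : p ^ 2 - E * r ^ 2 = n ^ m) (hn : n ≠ 0)
  (hpr : ∀ q, Prime q → ¬ q ∣ E → q ∣ p → ¬ q ∣ r)

include hDE hm h in
omit [IsDomain R] [UniqueFactorizationMonoid R] in
theorem wronskian_identities :
    2 * p * (p * D r - r * D p) = n ^ (m - 1) * (2 * n * D r - m * r * D n) ∧
    2 * E * r * (p * D r - r * D p) = n ^ (m - 1) * (2 * n * D p - m * p * D n) := by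
  obtain ⟨m, rfl⟩ : ∃ k, m = k + 1 := ⟨m - 1, by omega⟩
  have h1 := congrArg D h
  rw [map_sub, D.leibniz, D.leibniz_pow, D.leibniz_pow, D.leibniz_pow, hDE] at h1
  simp only [smul_eq_mul, nsmul_eq_mul, Nat.add_sub_cancel] at h1 ⊢
  rw [pow_succ] at h
  push_cast at *
  constructor
  · linear_combination 2 * D r * h - r * h1
  · linear_combination 2 * D p * h - p * h1

include hE hDE hm h hn hpr in
theorem pow_dvd_wronskian (h2 : IsUnit (2 : R)) : n ^ (m - 1) ∣ p * D r - r * D p := by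
  refine dvd_of_forall_prime_pow_dvd (pow_ne_zero _ hn) fun q hq k hk => ?_
  by_cases hqE : q ∣ E
  · have hDq := dvd_derivation_of_dvd D hE hDE hq hqE
    obtain ⟨e, rfl⟩ := hqE
    have he : ¬ q ∣ e := by
      rintro ⟨u, rfl⟩
      exact hq.not_isUnit (hE q ⟨u, by ring⟩)
    obtain ⟨i, j, hij, hi, hj⟩ := exists_pow_dvd_of_pow_dvd hq he k p r
      (h ▸ hk.trans (pow_dvd_pow _ (by omega)))
    refine (pow_dvd_pow q hij).trans ?_
    rw [pow_add]
    refine dvd_sub (mul_dvd_mul hi (pow_dvd_derivation D hDq hj)) ?_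
    rw [mul_comm r]
    exact mul_dvd_mul (pow_dvd_derivation D hDq hi) hj
  · obtain ⟨h3, h4⟩ := wronskian_identities D hDE hm h
    have hq2 : ¬ q ∣ 2 := fun h => hq.not_isUnit (isUnit_of_dvd_unit h h2)
    by_cases hqp : q ∣ p
    · have hqr := hpr q hq hqE hqp
      refine (hq.pow_dvd_of_dvd_mul_left k (a := 2 * E * r) ?_ (by
        rw [h4]; exact hk.mul_right _))
      intro h5
      rcases hq.dvd_or_dvd h5 with h5 | h5
      · rcases hq.dvd_or_dvd h5 with h5 | h5
        · exact hq2 h5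
        · exact hqE h5
      · exact hqr h5
    · refine (hq.pow_dvd_of_dvd_mul_left k (a := 2 * p) ?_ (by
        rw [h3]; exact hk.mul_right _))
      intro h5
      rcases hq.dvd_or_dvd h5 with h5 | h5
      · exact hq2 h5
      · exact hqp h5

include hE hDE hm h hn hpr in
theorem dvd_derivation_of_wronskian (hmu : IsUnit (m : R)) (hw : p * D r - r * D p = 0) :
    (2 * n * D r = m * r * D n ∧ 2 * n * D p = m * p * D n) ∧ n ∣ D n := by
  obtain ⟨h3, h4⟩ := wronskian_identities D hDE hm h
  rw [hw, mul_zero, eq_comm, mul_eq_zero] at h3 h4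
  have h3 := sub_eq_zero.mp (h3.resolve_left (pow_ne_zero _ hn))
  have h4 := sub_eq_zero.mp (h4.resolve_left (pow_ne_zero _ hn))
  refine ⟨⟨h3, h4⟩, ?_⟩
  refine dvd_of_forall_prime_pow_dvd hn fun q hq k hk => ?_
  by_cases hqE : q ∣ E
  · exact pow_dvd_derivation D (dvd_derivation_of_dvd D hE hDE hq hqE) hk
  · have hqm : ¬ q ∣ m := fun h => hq.not_isUnit (isUnit_of_dvd_unit h hmu)
    have key : ∀ x y, 2 * n * y = m * x * D n → ¬ q ∣ x → q ^ k ∣ D n := fun x y hxy hx => by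
      refine (hq.pow_dvd_of_dvd_mul_left k (a := m * x) ?_ (by
        rw [← hxy]; exact (hk.mul_left _).mul_right _))
      intro h5
      rcases hq.dvd_or_dvd h5 with h5 | h5
      · exact hqm h5
      · exact hx h5
    by_cases hqp : q ∣ p
    · exact key r _ h3 (hpr q hq hqE hqp)
    · exact key p _ h4 hqp

end UFD

end Kreweras

namespace Kreweras
open PowerSeries

section CoefficientwiseDerivation

/-- Derivations over the integers. -/
abbrev IntDer (R : Type*) [CommRing R] := Derivation ℤ R R

/-- A derivation from an additive map satisfying the Leibniz rule. -/
def IntDer.ofAddMonoidHom {R : Type*} [CommRing R] (D : R →+ R)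
    (h : ∀ a b, D (a * b) = a * D b + b * D a) : IntDer R :=
  Derivation.mk' D.toIntLinearMap h

theorem IntDer.apply_mul {R : Type*} [CommRing R] (D : IntDer R) (a b : R) :
    D (a * b) = a * D b + b * D a := Derivation.leibniz D a b

theorem IntDer.apply_pow {R : Type*} [CommRing R] (D : IntDer R) (a : R) (n : ℕ) :
    D (a ^ n) = n * a ^ (n - 1) * D a := by
  rw [Derivation.leibniz_pow D, smul_eq_mul, nsmul_eq_mul, mul_assoc]

theorem IntDer.apply_one {R : Type*} [CommRing R] (D : IntDer R) : D 1 = 0 :=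
  Derivation.map_one_eq_zero D

variable {K : Type*} [Field K] (δ : IntDer K)

/-- The additive map underlying `dser`. -/
def dserHom : PowerSeries K →+ PowerSeries K where
  toFun f := PowerSeries.mk fun n => δ (coeff n f)
  map_zero' := by ext; simp
  map_add' f g := by ext; simp

theorem coeff_dserHom (f : PowerSeries K) (n : ℕ) : coeff n (dserHom δ f) = δ (coeff n f) := by
  simp [dserHom]

/-- The coefficientwise extension of a derivation to power series. -/
def dser : IntDer (PowerSeries K) :=
  IntDer.ofAddMonoidHom (dserHom δ) fun f g => by
    ext n
    change coeff n (dserHom δ _) = coeff n (f * dserHom δ g + g * dserHom δ f)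
    rw [map_add, mul_comm g]
    simp only [coeff_dserHom, coeff_mul, map_sum, Derivation.leibniz, Finset.sum_add_distrib,
      smul_eq_mul]
    simp only [mul_comm]

theorem coeff_dser (f : PowerSeries K) (n : ℕ) : coeff n (dser δ f) = δ (coeff n f) :=
  coeff_dserHom δ f n

/-- The function underlying `dpoly`. -/
def dpolyFun (f : Polynomial K) : Polynomial K :=
  ∑ i ∈ Finset.range (f.natDegree + 1), Polynomial.monomial i (δ (f.coeff i))

theorem coeff_dpolyFun (f : Polynomial K) (n : ℕ) : (dpolyFun δ f).coeff n = δ (f.coeff n) := by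
  rw [dpolyFun, Polynomial.finsetSum_coeff]
  simp only [Polynomial.coeff_monomial, Finset.sum_ite_eq', Finset.mem_range]
  split_ifs with h
  · rfl
  · rw [Polynomial.coeff_eq_zero_of_natDegree_lt (by omega), map_zero]

/-- The additive map underlying `dpoly`. -/
def dpolyHom : Polynomial K →+ Polynomial K where
  toFun := dpolyFun δ
  map_zero' := by ext; simp [coeff_dpolyFun]
  map_add' f g := by ext; simp [coeff_dpolyFun]

/-- The coefficientwise extension of a derivation to polynomials. -/
def dpoly : IntDer (Polynomial K) :=
  IntDer.ofAddMonoidHom (dpolyHom δ) fun f g => by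
    ext n
    change (dpolyFun δ _).coeff n = (f * dpolyFun δ g + g * dpolyFun δ f).coeff n
    rw [Polynomial.coeff_add, mul_comm g]
    simp only [coeff_dpolyFun, Polynomial.coeff_mul, map_sum, Derivation.leibniz,
      Finset.sum_add_distrib, smul_eq_mul]
    simp only [mul_comm]

theorem coeff_dpoly (f : Polynomial K) (n : ℕ) : (dpoly δ f).coeff n = δ (f.coeff n) :=
  coeff_dpolyFun δ f n

theorem dser_C (a : K) : dser δ (C a) = C (δ a) := by
  ext n; rw [coeff_dser, coeff_C, coeff_C]; split_ifs <;> simp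

theorem dser_X : dser δ X = 0 := by
  ext n; rw [coeff_dser, coeff_X]; split_ifs <;> simp

theorem coe_dpoly (f : Polynomial K) : (dpoly δ f : PowerSeries K) = dser δ f := by
  ext n; rw [coeff_dser, Polynomial.coeff_coe, Polynomial.coeff_coe, coeff_dpoly]

theorem dpoly_C (a : K) : dpoly δ (Polynomial.C a) = Polynomial.C (δ a) := by
  ext n; rw [coeff_dpoly, Polynomial.coeff_C, Polynomial.coeff_C]; split_ifs <;> simp

theorem dpoly_X : dpoly δ Polynomial.X = 0 := by
  ext n; rw [coeff_dpoly, Polynomial.coeff_X]; split_ifs <;> simp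

theorem natDegree_dpoly_le (f : Polynomial K) : (dpoly δ f).natDegree ≤ f.natDegree := by
  refine Polynomial.natDegree_le_iff_coeff_eq_zero.mpr fun N hN => ?_
  rw [coeff_dpoly, Polynomial.coeff_eq_zero_of_natDegree_lt hN, map_zero]

theorem leibniz_pow_of_eq_zero {R : Type*} [CommRing R] (D : Derivation ℤ R R) {a : R}
    (h : D a = 0) (n : ℕ) : D (a ^ n) = 0 := by
  rw [D.leibniz_pow, h, smul_zero, smul_zero]

variable {τ : K} (hτ : δ τ = 0)

include hτ in
theorem dpoly_cub : dpoly δ (cub τ) = 0 := by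
  rw [cub, map_sub, map_add, Derivation.leibniz, leibniz_pow_of_eq_zero _ (dpoly_X δ), dpoly_C, hτ,
    dpoly_X, Derivation.map_one_eq_zero]
  simp

include hτ in
theorem dpoly_hom (N : ℕ) (p : Polynomial K) : dpoly δ (hom τ N p) = hom τ N (dpoly δ p) := by
  rw [hom, hom, map_sum]
  refine Finset.sum_congr rfl fun i _ => ?_
  rw [Derivation.leibniz, Derivation.leibniz, leibniz_pow_of_eq_zero _ (dpoly_X δ),
    leibniz_pow_of_eq_zero _ (dpoly_cub δ hτ), dpoly_C, coeff_dpoly]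
  simp only [smul_eq_mul]
  ring

include hτ in
theorem dpoly_ram : dpoly δ (ram τ) = 0 := by
  have h1 : ∀ n : ℕ, δ ((OfNat.ofNat (n + 2) : ℕ) : K) = 0 := fun n => δ.map_natCast _
  have h4 : δ 4 = 0 := by simpa using h1 2
  have h18 : δ 18 = 0 := by simpa using h1 16
  have h27 : δ 27 = 0 := by simpa using h1 25
  have hx : ∀ n, dpoly δ (Polynomial.X ^ n) = 0 := leibniz_pow_of_eq_zero _ (dpoly_X δ)
  simp only [ram, map_add, map_sub, map_neg, Derivation.leibniz, dpoly_C, hx, dpoly_X, hτ, h4, h18,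
    h27, leibniz_pow_of_eq_zero δ hτ, smul_zero, map_zero, add_zero, neg_zero, sub_zero, neg_mul]

theorem dser_w (c : Curve τ) (hτ : δ τ = 0) (h0 : c.w1 - c.w2 ≠ 0) :
    dser δ c.w1 = 0 ∧ dser δ c.w2 = 0 := by
  have h1 := congrArg (dser δ) c.sum
  have h2 := congrArg (dser δ) c.prod
  rw [map_add, map_sub, dser_X, IntDer.apply_one (dser δ), sub_zero] at h1
  rw [IntDer.apply_mul (dser δ), IntDer.apply_mul (dser δ), leibniz_pow_of_eq_zero _ (dser_X δ), dser_C, hτ] at h2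
  simp only [map_zero, mul_zero, add_zero] at h2
  have h3 : (c.w1 - c.w2) * dser δ c.w1 = 0 := by linear_combination c.w1 * h1 - h2
  have h4 := (mul_eq_zero.mp h3).resolve_left h0
  exact ⟨h4, by rw [h4, zero_add] at h1; exact h1⟩

end CoefficientwiseDerivation

end Kreweras

namespace Kreweras
open PowerSeries

variable {K : Type*} [Field K] [Algebra (PowerSeries ℂ) K] [IsFractionRing (PowerSeries ℂ) K]

theorem dser_vv (δ : IntDer K) (hτ : δ (tau K) = 0) : dser δ (vv K) = 0 := by
  obtain ⟨h1, h2⟩ := dser_w δ (cv K) hτ w1_ne_w2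
  have h3 : dpoly δ (fac (tau K)) = 0 := by
    have hx : dpoly δ (Polynomial.X ^ 3) = 0 := leibniz_pow_of_eq_zero _ (dpoly_X δ) 3
    have h4 : dpoly δ 2 = 0 := by
      have := dpoly_C δ 2
      rw [map_ofNat] at this
      rw [this]
      simpa using Derivation.map_natCast δ 2
    rw [fac, map_add, map_sub, IntDer.apply_mul, hx, dpoly_C, hτ, dpoly_X, h4]
    simp
  rw [vv, IntDer.apply_mul, map_sub, h1, h2, ← coe_dpoly, h3]
  simp

theorem exists_norm [CharZero K] {f g : PowerSeries K} (hB : InBB f g) {γ δ : K} (hγ : γ * δ = 1)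
    (h : IsInv (cv K) 2 γ f g) :
    ∃ n : Polynomial K, 2 * n.natDegree ≤ 4 ∧ f * g = (hom (tau K) 4 n : PowerSeries K) := by
  have h1 := h.mul (h.swap (by rw [mul_comm, hγ]))
  rw [hγ] at h1
  obtain ⟨n, r, hn, -, e1, e2⟩ := repr_of_isInv 4 (hB.mul hB.swap) h1
  refine ⟨n, hn, ?_⟩
  have h2 : (2 : PowerSeries K) * (f * g) = 2 * (hom (tau K) 4 n : PowerSeries K) := by
    linear_combination e1 + e2
  refine mul_left_cancel₀ (fun h => ?_) h2
  have := congrArg (constantCoeff (R := K)) h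
  rw [map_ofNat, map_zero] at this
  exact two_ne_zero this

theorem norm_equation [CharZero K] {f g : PowerSeries K} {m : ℕ} {p r n : Polynomial K}
    (hp : 2 * p.natDegree ≤ 2 * m) (hr : r = 0 ∨ 2 * r.natDegree + 3 ≤ 2 * m)
    (hn : 2 * n.natDegree ≤ 4)
    (hfm : f ^ m = (hom (tau K) (2 * m) p : PowerSeries K) +
      vv K * (hom (tau K) (2 * m - 3) r : PowerSeries K))
    (hgm : g ^ m = (hom (tau K) (2 * m) p : PowerSeries K) -
      vv K * (hom (tau K) (2 * m - 3) r : PowerSeries K))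
    (hfg : f * g = (hom (tau K) 4 n : PowerSeries K)) :
    p ^ 2 - ram (tau K) * r ^ 2 = n ^ m := by
  have hram := natDegree_ram_le (tau K)
  have hp2 : 2 * (p ^ 2).natDegree ≤ m * 4 := by
    have := Polynomial.natDegree_pow_le (p := p) (n := 2); omega
  have hr2 : 2 * (ram (tau K) * r ^ 2).natDegree ≤ m * 4 := by
    rcases hr with rfl | hr
    · simp
    · have h1 := Polynomial.natDegree_pow_le (p := r) (n := 2)
      have h2 := Polynomial.natDegree_mul_le (p := ram (tau K)) (q := r ^ 2)
      omega
  refine hom_injective (tau K) (N := m * 4) ?_ ?_ ?_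
  · have := Polynomial.natDegree_sub_le (p ^ 2) (ram (tau K) * r ^ 2)
    rcases le_max_iff.mp this with h | h <;> omega
  · have := Polynomial.natDegree_pow_le (p := n) (n := m)
    have : m * n.natDegree ≤ m * 2 := Nat.mul_le_mul_left _ (by omega)
    omega
  have e1 : hom (tau K) (m * 4) (p ^ 2) = hom (tau K) (2 * m) p ^ 2 := by
    rw [← hom_pow _ hp]; congr 1; ring
  have e2 : (hom (tau K) (m * 4) (ram (tau K) * r ^ 2) : PowerSeries K) =
      vv K ^ 2 * (hom (tau K) (2 * m - 3) r : PowerSeries K) ^ 2 := by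
    rcases hr with rfl | hr
    · simp [hom_zero]
    · rw [vv_sq, ← Polynomial.coe_pow, ← Polynomial.coe_mul, ← hom_pow _ (by omega),
        ← hom_mul _ (by omega)]
      · congr 2; omega
      · have h1 := Polynomial.natDegree_pow_le (p := r) (n := 2); omega
  apply Polynomial.coe_injective
  rw [hom_sub, e1, Polynomial.coe_sub, Polynomial.coe_pow, e2, hom_pow _ hn, Polynomial.coe_pow,
    ← hfg, mul_pow, hfm, hgm]
  ring

theorem hom_wronskian (δ : IntDer K) {m : ℕ} {p r n : Polynomial K}
    (hp : 2 * p.natDegree ≤ 2 * m) (hr : r = 0 ∨ 2 * r.natDegree + 3 ≤ 2 * m)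
    (hn : 2 * n.natDegree ≤ 4) {κ : K}
    (hκ : p * dpoly δ r - r * dpoly δ p = Polynomial.C κ * n ^ (m - 1)) :
    hom (tau K) (2 * m) p * hom (tau K) (2 * m - 3) (dpoly δ r) -
      hom (tau K) (2 * m - 3) r * hom (tau K) (2 * m) (dpoly δ p) =
      Polynomial.C κ * (Polynomial.X * hom (tau K) 4 n ^ (m - 1)) ∨ r = 0 := by
  refine or_iff_not_imp_right.mpr fun hr0 => ?_
  have hr := hr.resolve_left hr0
  have h1 := natDegree_dpoly_le δ p
  have h2 := natDegree_dpoly_le δ r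
  rw [← hom_mul _ hp (by omega), ← hom_mul _ (by omega) (by omega), add_comm (2 * m - 3), ← hom_sub,
    hκ, hom_C_mul, ← hom_pow _ hn, show 2 * m + (2 * m - 3) = 1 + (m - 1) * 4 by omega,
    ← one_mul (n ^ (m - 1)), hom_mul, hom_one, one_mul, pow_one]
  · simp
  · have := Polynomial.natDegree_pow_le (p := n) (n := m - 1)
    have : (m - 1) * n.natDegree ≤ (m - 1) * 2 := Nat.mul_le_mul_left _ (by omega)
    omega

theorem dser_eq_zero_of_isInv [CharZero K] (δ : IntDer K) (hτ : δ (tau K) = 0)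
    (h0 : tau K ≠ 0) (h27 : 1 - 27 * tau K ≠ 0) {f g : PowerSeries K} (hB : InBB f g)
    {γ : ℂ} {m : ℕ} (hm : m ≠ 0) (hγm : γ ^ m = 1) (hγ1 : γ ≠ 1)
    (h : IsInv (cv K) 2 (algebraMap (PowerSeries ℂ) K (C γ)) f g)
    (hf : constantCoeff f ≠ 0) (hg : constantCoeff g ≠ 0) {F G : PowerSeries K}
    (hF : dser δ f = X ^ 2 * F) (hG : dser δ g = X ^ 2 * G) : dser δ f = 0 := by
  have hγ0 : γ ≠ 0 := by rintro rfl; rw [zero_pow hm] at hγm; exact zero_ne_one hγm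
  have hf0 : f ≠ 0 := by rintro rfl; exact hf (map_zero _)
  have hg0 : g ≠ 0 := by rintro rfl; exact hg (map_zero _)
  have hmK : (m : K) ≠ 0 := Nat.cast_ne_zero.mpr hm
  obtain ⟨n, hn, hfg⟩ := exists_norm hB (δ := algebraMap (PowerSeries ℂ) K (C γ⁻¹))
    (by rw [← map_mul, ← map_mul, mul_inv_cancel₀ hγ0, map_one, map_one]) h
  have hinvm := h.pow m
  rw [← map_pow, ← map_pow, hγm, map_one, map_one, mul_comm m 2] at hinvm
  obtain ⟨p, r, hp, hr, hfm, hgm⟩ := repr_of_isInv _ (hB.pow m) hinvm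
  have heq := norm_equation hp hr hn hfm hgm hfg
  have hn0 : n ≠ 0 := by
    rintro rfl
    rw [hom_zero, Polynomial.coe_zero] at hfg
    exact mul_ne_zero hf0 hg0 hfg
  have hn2 : n.coeff 2 = constantCoeff f * constantCoeff g := by
    have := congrArg constantCoeff hfg
    rw [map_mul, Polynomial.constantCoeff_coe, show 4 = 2 * 2 from rfl, coeff_zero_hom] at this
    rw [this]; ring
  have hsq : Squarefree (ram (tau K)) := (separable_ram _ h0 h27).squarefree
  have hpr : ∀ q, Prime q → ¬ q ∣ ram (tau K) → q ∣ p → ¬ q ∣ r := fun q hq hqE hqp =>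
    not_dvd_of_isInv hB hγ0 hγ1 h hf0 hm hp hr hfm hgm hq.irreducible hqE hqp
  have hram := dpoly_ram δ hτ
  have hu2 : IsUnit (2 : Polynomial K) := by
    rw [← map_ofNat Polynomial.C 2]; exact (IsUnit.mk0 _ two_ne_zero).map _
  have hum : IsUnit ((m : ℕ) : Polynomial K) := by
    rw [← map_natCast (Polynomial.C : K →+* Polynomial K) m]; exact (IsUnit.mk0 _ hmK).map _
  obtain ⟨u, hu⟩ := pow_dvd_wronskian (dpoly δ) hsq hram hm heq hn0 hpr hu2
  have hnd : n.natDegree = 2 := le_antisymm (by omega)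
    (Polynomial.le_natDegree_of_ne_zero (by rw [hn2]; exact mul_ne_zero hf hg))
  -- degree count
  obtain ⟨κ, hκ⟩ : ∃ κ, p * dpoly δ r - r * dpoly δ p = Polynomial.C κ * n ^ (m - 1) := by
    rcases eq_or_ne u 0 with rfl | hu0
    · exact ⟨0, by rw [hu]; simp⟩
    · rcases hr with rfl | hr
      · exact ⟨0, by simp⟩
      have h1 := natDegree_dpoly_le δ p
      have h2 := natDegree_dpoly_le δ r
      have h3 := Polynomial.natDegree_sub_le (p * dpoly δ r) (r * dpoly δ p)
      have h4 := Polynomial.natDegree_mul_le (p := p) (q := dpoly δ r)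
      have h5 := Polynomial.natDegree_mul_le (p := r) (q := dpoly δ p)
      have h6 := Polynomial.natDegree_mul (pow_ne_zero (m - 1) hn0) hu0
      rw [Polynomial.natDegree_pow, hnd, ← hu] at h6
      have h7 : u.natDegree = 0 := by
        rcases le_max_iff.mp h3 with h | h <;> omega
      obtain ⟨κ, rfl⟩ := Polynomial.natDegree_eq_zero.mp h7
      exact ⟨κ, by rw [hu, mul_comm]⟩
  have hDf : dser δ (f ^ m) = (hom (tau K) (2 * m) (dpoly δ p) : PowerSeries K) +
      vv K * (hom (tau K) (2 * m - 3) (dpoly δ r) : PowerSeries K) := by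
    rw [hfm, map_add, IntDer.apply_mul, dser_vv δ hτ, ← coe_dpoly, ← coe_dpoly, dpoly_hom δ hτ,
      dpoly_hom δ hτ]
    ring
  have hDg : dser δ (g ^ m) = (hom (tau K) (2 * m) (dpoly δ p) : PowerSeries K) -
      vv K * (hom (tau K) (2 * m - 3) (dpoly δ r) : PowerSeries K) := by
    rw [hgm, map_sub, IntDer.apply_mul, dser_vv δ hτ, ← coe_dpoly, ← coe_dpoly, dpoly_hom δ hτ,
      dpoly_hom δ hτ]
    ring
  have hpow : ∀ x : PowerSeries K, dser δ (x ^ m) = C (m : K) * x ^ (m - 1) * dser δ x := by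
    intro x
    rw [IntDer.apply_pow, map_natCast]
  have hw : p * dpoly δ r - r * dpoly δ p = 0 := by
    rcases hom_wronskian δ hp hr hn hκ with h1 | rfl
    swap
    · simp
    have h1 := congrArg Polynomial.toPowerSeries h1
    rw [Polynomial.coe_sub, Polynomial.coe_mul, Polynomial.coe_mul, Polynomial.coe_mul,
      Polynomial.coe_mul, Polynomial.coe_C, Polynomial.coe_X, Polynomial.coe_pow, ← hfg] at h1
    have h2 : g ^ m * dser δ (f ^ m) - f ^ m * dser δ (g ^ m) =
        2 * vv K * (C κ * (X * (f * g) ^ (m - 1))) := by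
      rw [hDf, hDg, hfm, hgm]; linear_combination 2 * vv K * h1
    rw [hpow, hpow, hF, hG] at h2
    obtain ⟨k, rfl⟩ : ∃ k, m = k + 1 := ⟨m - 1, by omega⟩
    rw [Nat.add_sub_cancel] at h2
    have h3 : C ((k + 1 : ℕ) : K) * (X * (g * F - f * G)) = 2 * vv K * C κ := by
      apply mul_left_cancel₀ (mul_ne_zero (X_ne_zero (R := K)) (pow_ne_zero k (mul_ne_zero hf0 hg0)))
      linear_combination h2
    have h4 := congrArg constantCoeff h3
    simp only [map_mul, constantCoeff_vv, constantCoeff_C, constantCoeff_X, map_ofNat] at h4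
    have h5 : κ = 0 := by linear_combination (-1 / 4 : K) * h4.symm
    rw [hκ, h5]; simp
  obtain ⟨⟨h1, h2⟩, h3⟩ := dvd_derivation_of_wronskian (dpoly δ) hsq hram hm heq hn0 hpr hum hw
  have hδf : δ (constantCoeff f) = 0 := by
    rw [← coeff_zero_eq_constantCoeff_apply, ← coeff_dser, hF]; simp
  have hδg : δ (constantCoeff g) = 0 := by
    rw [← coeff_zero_eq_constantCoeff_apply, ← coeff_dser, hG]; simp
  have hDn : dpoly δ n = 0 := by
    by_contra hne
    have h4 := Polynomial.natDegree_le_of_dvd h3 hne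
    have h5 := natDegree_dpoly_le δ n
    apply hne
    rw [← Polynomial.leadingCoeff_eq_zero, Polynomial.leadingCoeff, le_antisymm h5 h4, coeff_dpoly,
      hnd, hn2, δ.leibniz, hδf, hδg]
    simp
  rw [hDn, mul_zero] at h1 h2
  have h2n : 2 * n ≠ 0 := mul_ne_zero hu2.ne_zero hn0
  have h1 := (mul_eq_zero.mp h1).resolve_left h2n
  have h2 := (mul_eq_zero.mp h2).resolve_left h2n
  rw [h1, h2, hom_zero, hom_zero, Polynomial.coe_zero, mul_zero, add_zero, hpow] at hDf
  refine (mul_eq_zero.mp hDf).resolve_left (mul_ne_zero (fun h => hmK ?_) (pow_ne_zero _ hf0))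
  simpa using congrArg (constantCoeff (R := K)) h

end Kreweras

namespace Kreweras

section Counting

/-- The paths counted by `pathCount`. -/
abbrev WalkTo (step : WSt → WSt → Prop) (n : ℕ) (v : WSt) : Type :=
  {p : Fin (n + 1) → WSt //
    p 0 = ((0 : ℤ), 0, 0) ∧ p (Fin.last n) = v ∧ ∀ i : Fin n, step (p i.castSucc) (p i.succ)}

/-- Removing the last step of a path. -/
def walkSuccEquiv (step : WSt → WSt → Prop) (n : ℕ) (v : WSt) :
    WalkTo step (n + 1) v ≃ Σ u : {u // step u v}, WalkTo step n u where
  toFun p := ⟨⟨p.1 (Fin.last n).castSucc, by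
      have h := p.2.2.2 (Fin.last n)
      rwa [Fin.succ_last, p.2.2.1] at h⟩,
    ⟨fun i => p.1 i.castSucc, p.2.1, rfl, fun i => by
      have h := p.2.2.2 i.castSucc
      rwa [Fin.succ_castSucc] at h⟩⟩
  invFun q := ⟨Fin.snoc (α := fun _ => WSt) q.2.1 v,
    (Fin.snoc_castSucc (α := fun _ => WSt) v q.2.1 0).trans q.2.2.1, by
      rw [Fin.snoc_last], fun i => by
      refine Fin.lastCases ?_ (fun j => ?_) i
      · rw [Fin.succ_last, Fin.snoc_last, Fin.snoc_castSucc, q.2.2.2.1]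
        exact q.1.2
      · rw [Fin.succ_castSucc, Fin.snoc_castSucc, Fin.snoc_castSucc]
        exact q.2.2.2.2 j⟩
  left_inv p := by
    apply Subtype.ext
    funext i
    refine Fin.lastCases ?_ (fun j => ?_) i
    · simp only [Fin.snoc_last]; exact p.2.2.1.symm
    · simp only [Fin.snoc_castSucc]
  right_inv q := by
    refine Sigma.subtype_ext (Subtype.ext ?_) (funext fun i => ?_)
    · simp only [Fin.snoc_castSucc]; exact q.2.2.2.1
    · simp only [Fin.snoc_castSucc]

/-- The states from which a state can be reached in one step. -/
def preds (v : WSt) : Finset WSt :=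
  (if 1 ≤ v.2.1 ∧ 1 ≤ v.2.2 then {(v.1, v.2.1 - 1, v.2.2 - 1)} else ∅) ∪
  {(v.1, v.2.1, v.2.2 + 1)} ∪ {(v.1, v.2.1 + 1, v.2.2)} ∪
  (if v.2.2 = 0 then {(v.1 - 1, 0, v.2.1 + 1)} else ∅) ∪
  (if v.2.1 = 0 ∧ 2 ≤ v.2.2 then {(v.1 + 1, v.2.2 - 2, 0)} else ∅)

theorem mem_preds (u v : WSt) : u ∈ preds v ↔ vertStep u v := by
  obtain ⟨k, a, b⟩ := v
  obtain ⟨k', a', b'⟩ := u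
  simp only [preds, vertStep, Finset.mem_union]
  split_ifs <;> simp only [Finset.mem_singleton, Finset.notMem_empty, Prod.mk.injEq] <;>
    by_cases hk : k = k' <;> by_cases hk2 : k = k' + 1 <;> by_cases hk3 : k = k'-1 <;> simp [hk, hk2,hk3] <;> omega

theorem sum_preds {M : Type*} [AddCommMonoid M] (f : WSt → M) (k : ℤ) (a b : ℕ) :
    ∑ u ∈ preds (k, a, b), f u =
      (if 1 ≤ a ∧ 1 ≤ b then f (k, a - 1, b - 1) else 0) + f (k, a, b + 1) + f (k, a + 1, b) +
      (if b = 0 then f (k - 1, 0, a + 1) else 0) +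
      (if a = 0 ∧ 2 ≤ b then f (k + 1, b - 2, 0) else 0) := by
  rw [preds, Finset.sum_union, Finset.sum_union, Finset.sum_union, Finset.sum_union]
  · dsimp only
    split_ifs <;> simp
  all_goals
    rw [Finset.disjoint_left]
    rintro ⟨k', a', b'⟩ h1 h2
    simp only [Finset.mem_union] at h1
    split_ifs at h1 h2 <;> simp at h1 h2 <;> omega

instance finite_walkTo (n : ℕ) (v : WSt) : Finite (WalkTo vertStep n v) := by
  induction n generalizing v with
  | zero =>
    refine Finite.of_injective (fun p : WalkTo vertStep 0 v => (0 : Fin 1)) fun p q _ => ?_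
    apply Subtype.ext
    funext i
    rw [Fin.fin_one_eq_zero i, p.2.1, q.2.1]
  | succ n ih =>
    have : Finite {u // vertStep u v} :=
      Set.Finite.to_subtype ((preds v).finite_toSet.subset fun u hu => (mem_preds u v).mpr hu)
    exact Finite.of_equiv _ (walkSuccEquiv vertStep n v).symm

theorem pathCount_succ (n : ℕ) (v : WSt) :
    pathCount vertStep (n + 1) v = ∑ u ∈ preds v, pathCount vertStep n u := by
  have e : {u // vertStep u v} ≃ {u // u ∈ preds v} :=
    Equiv.subtypeEquivRight fun u => (mem_preds u v).symm
  have : Fintype {u // vertStep u v} := Fintype.ofEquiv _ e.symm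
  have h : pathCount vertStep (n + 1) v = ∑ u : {u // vertStep u v}, pathCount vertStep n u := by
    rw [show pathCount vertStep (n + 1) v = Nat.card (WalkTo vertStep (n + 1) v) from rfl,
      Nat.card_congr (walkSuccEquiv vertStep n v), Nat.card_sigma]
    rfl
  rw [h, ← Finset.sum_coe_sort (preds v)]
  exact Fintype.sum_equiv (Equiv.subtypeEquivRight fun u => (mem_preds u v).symm) _ _ fun _ => rfl

theorem pathCount_zero (v : WSt) : pathCount vertStep 0 v = if v = (0, 0, 0) then 1 else 0 := by
  rw [show pathCount vertStep 0 v = Nat.card (WalkTo vertStep 0 v) from rfl]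
  split_ifs with h
  · rw [Nat.card_eq_one_iff_unique]
    refine ⟨⟨fun p q => Subtype.ext (funext fun i => ?_)⟩,
      ⟨⟨fun _ => (0, 0, 0), rfl, h.symm, fun i => i.elim0⟩⟩⟩
    rw [Fin.fin_one_eq_zero i, p.2.1, q.2.1]
  · have : IsEmpty (WalkTo vertStep 0 v) := ⟨fun p => h (p.2.2.1.symm.trans p.2.1)⟩
    exact Nat.card_of_isEmpty

/-- The number of walks from the origin to position `(a, b)`, weighted by the winding angle. -/
def walkWeight (s : ℂ) : ℕ → ℕ → ℕ → ℂ
  | 0, a, b => if a = 0 ∧ b = 0 then 1 else 0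
  | n + 1, a, b =>
    (if 1 ≤ a ∧ 1 ≤ b then walkWeight s n (a - 1) (b - 1) else 0) + walkWeight s n a (b + 1) +
      walkWeight s n (a + 1) b + (if b = 0 then s * walkWeight s n 0 (a + 1) else 0) +
      (if a = 0 ∧ 2 ≤ b then s⁻¹ * walkWeight s n (b - 2) 0 else 0)

theorem hasSum_walkWeight {s : ℂ} (hs : s ≠ 0) (n a b : ℕ) :
    HasSum (fun k : ℤ => (pathCount vertStep n (k, a, b) : ℂ) * s ^ k) (walkWeight s n a b) := by
  induction n generalizing a b with
  | zero =>
    rw [walkWeight]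
    convert hasSum_single (f := fun k : ℤ => (pathCount vertStep 0 (k, a, b) : ℂ) * s ^ k) 0 ?_
      using 1
    · simp only [pathCount_zero, Prod.mk.injEq, true_and, zpow_zero, mul_one]
      split_ifs <;> simp
    · intro k hk
      simp [pathCount_zero, hk]
  | succ n ih =>
    have hshift : ∀ (a b : ℕ) (j : ℤ), HasSum
        (fun k : ℤ => (pathCount vertStep n (k - j, a, b) : ℂ) * s ^ k)
        (s ^ j * walkWeight s n a b) := by
      intro a b j
      have h := ((Equiv.subRight j).hasSum_iff.mpr (ih a b)).mul_left (s ^ j)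
      refine h.congr_fun fun k => ?_
      simp only [Function.comp, Equiv.subRight_apply]
      rw [zpow_sub₀ hs]
      field_simp
    have hite : ∀ (c : Prop) [Decidable c] (f : ℤ → ℂ) (x : ℂ), HasSum f x →
        HasSum (fun k => if c then f k else 0) (if c then x else 0) := by
      intro c _ f x h
      split_ifs
      · exact h
      · exact hasSum_zero
    have h := ((((hite (1 ≤ a ∧ 1 ≤ b) _ _ (ih (a - 1) (b - 1))).add (ih a (b + 1))).add
      (ih (a + 1) b)).add (hite (b = 0) _ _ (hshift 0 (a + 1) 1))).add
      (hite (a = 0 ∧ 2 ≤ b) _ _ (hshift (b - 2) 0 (-1)))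
    rw [walkWeight]
    rw [zpow_one, zpow_neg_one] at h
    refine h.congr_fun fun k => ?_
    rw [pathCount_succ, sum_preds, sub_neg_eq_add]
    push_cast
    simp only [add_mul, ite_mul, zero_mul]

theorem tsum_eVert {s : ℂ} (hs : s ≠ 0) (n : ℕ) :
    ∑' k : ℤ, (eVert n k : ℂ) * s ^ k = walkWeight s n 0 0 :=
  (hasSum_walkWeight hs n 0 0).tsum_eq

end Counting

end Kreweras

namespace Kreweras
open PowerSeries

section Kernel
variable {K : Type*} [Field K] {τ : K} (c : Curve τ)

/-- Evaluation of `∑ G_b y^b` at `y = X * c.i`. -/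
def rowEval (G : ℕ → PowerSeries K) : PowerSeries K :=
  mk fun n => ∑ b ∈ Finset.range (n + 1), coeff n (G b * (X * c.i) ^ b)

theorem coeff_mul_pow_eq_zero (g : PowerSeries K) {n b : ℕ} (h : n < b) :
    coeff n (g * (X * c.i) ^ b) = 0 := by
  have h1 : (X : PowerSeries K) ^ b ∣ g * (X * c.i) ^ b :=
    Dvd.dvd.mul_left (by rw [mul_pow]; exact dvd_mul_right _ _) _
  exact X_pow_dvd_iff.mp h1 n h

theorem coeff_rowEval (G : ℕ → PowerSeries K) {n N : ℕ} (h : n < N) :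
    coeff n (rowEval c G) = ∑ b ∈ Finset.range N, coeff n (G b * (X * c.i) ^ b) := by
  rw [rowEval, coeff_mk]
  refine Finset.sum_subset (Finset.range_mono h) fun b _ hb => ?_
  exact coeff_mul_pow_eq_zero c _ (by simpa using hb)

theorem rowEval_add (G H : ℕ → PowerSeries K) :
    rowEval c (fun b => G b + H b) = rowEval c G + rowEval c H := by
  ext n
  simp only [rowEval, coeff_mk, map_add, add_mul, Finset.sum_add_distrib]

theorem rowEval_sub (G H : ℕ → PowerSeries K) :
    rowEval c (fun b => G b - H b) = rowEval c G - rowEval c H := by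
  ext n
  simp only [rowEval, coeff_mk, map_sub, sub_mul, Finset.sum_sub_distrib]

theorem rowEval_mul_left (u : PowerSeries K) (G : ℕ → PowerSeries K) :
    rowEval c (fun b => u * G b) = u * rowEval c G := by
  ext n
  rw [coeff_mul, rowEval, coeff_mk]
  have h : ∀ p ∈ Finset.HasAntidiagonal.antidiagonal n, coeff p.1 u * coeff p.2 (rowEval c G) =
      ∑ b ∈ Finset.range (n + 1), coeff p.1 u * coeff p.2 (G b * (X * c.i) ^ b) := by
    intro p hp
    rw [coeff_rowEval c G (N := n + 1) (by have := Finset.HasAntidiagonal.mem_antidiagonal.mp hp; omega),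
      Finset.mul_sum]
  rw [Finset.sum_congr rfl h, Finset.sum_comm]
  refine Finset.sum_congr rfl fun b _ => ?_
  rw [mul_assoc, coeff_mul]

theorem rowEval_single (u : PowerSeries K) :
    rowEval c (fun b => if b = 0 then u else 0) = u := by
  ext n
  rw [rowEval, coeff_mk, Finset.sum_eq_single_of_mem 0 (by simp)]
  · simp
  · intro b _ hb
    simp [hb]

theorem rowEval_shift (G : ℕ → PowerSeries K) :
    rowEval c (fun b => if 1 ≤ b then G (b - 1) else 0) = X * c.i * rowEval c G := by
  rw [← rowEval_mul_left]
  ext n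
  rw [coeff_rowEval c _ (N := n + 2) (by omega), coeff_rowEval c _ (N := n + 1) (by omega),
    Finset.sum_range_succ']
  simp only [Nat.le_add_left, if_true, Nat.add_sub_cancel, nonpos_iff_eq_zero, one_ne_zero,
    if_false, zero_mul, map_zero, add_zero]
  refine Finset.sum_congr rfl fun b _ => ?_
  rw [pow_succ]; congr 1; ring

theorem rowEval_C (g : ℕ → K) : rowEval c (fun b => C (g b)) = c.σ (mk g) := by
  ext n
  have h : (X : PowerSeries K) ^ (n + 1) ∣ mk g - ((trunc (n + 1) (mk g) : Polynomial K) :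
      PowerSeries K) := by
    rw [X_pow_dvd_iff]
    intro m hm
    rw [map_sub, Polynomial.coeff_coe, coeff_trunc, if_pos hm, sub_self]
  obtain ⟨r, hr⟩ := h
  have h1 : c.σ (mk g) = c.σ ((trunc (n + 1) (mk g) : Polynomial K) : PowerSeries K) +
      c.σ r * (X * c.i) ^ (n + 1) := by
    have h2 := congrArg c.σ (eq_add_of_sub_eq hr)
    rw [map_add, map_mul, map_pow, c.σ_X] at h2
    rw [h2]; ring
  rw [h1, map_add, coeff_mul_pow_eq_zero c _ (Nat.lt_succ_self n), add_zero,
    coeff_rowEval c _ (N := n + 1) (Nat.lt_succ_self n), trunc_apply]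
  rw [← map_sum]
  congr 1
  rw [← Polynomial.coeToPowerSeries.ringHom_apply, map_sum, map_sum, Nat.Ico_zero_eq_range]
  refine Finset.sum_congr rfl fun b _ => ?_
  rw [Polynomial.coeToPowerSeries.ringHom_apply, ← Polynomial.C_mul_X_pow_eq_monomial,
    Polynomial.coe_mul, Polynomial.coe_pow, Polynomial.coe_C, Polynomial.coe_X, map_mul, map_pow,
    c.σ_X, c.σ_C, coeff_mk]

theorem Curve.kernel : X * (X * c.i) - X - X * c.i - C τ * X ^ 2 * (X * c.i) ^ 2 = 0 := by
  linear_combination (X * c.i) * c.i * c.prod - X * c.i * c.sum +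
    (X - X * c.i * c.w2) * c.inv

/-- The kernel equation at the root of the kernel. -/
theorem kernel_equation {s : K} {f : ℕ → ℕ → K}
    (hf : ∀ a b, f a b = (if a = 0 ∧ b = 0 then 1 else 0) +
      (if 1 ≤ a ∧ 1 ≤ b then τ * f (a - 1) (b - 1) else 0) + f a (b + 1) + f (a + 1) b +
      (if b = 0 then s * f 0 (a + 1) else 0) +
      (if a = 0 ∧ 2 ≤ b then s⁻¹ * (τ * f (b - 2) 0) else 0)) :
    X - c.w1 * mk (fun a => f a 0) - c.σ (mk (f 0)) + C s * (mk (f 0) - C (f 0 0)) +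
      C s⁻¹ * (c.w2 * c.i) * c.σ (mk fun a => f a 0) = 0 := by
  set G : ℕ → PowerSeries K := fun b => mk fun a => f a b with hG
  set A : PowerSeries K := mk fun a => f a 0 with hA
  set B : PowerSeries K := mk (f 0) with hB
  have hrow : ∀ b, X * G b = (if b = 0 then X else 0) +
      (if 1 ≤ b then C τ * X ^ 2 * G (b - 1) else 0) + X * G (b + 1) + (G b - C (f 0 b)) +
      (if b = 0 then C s * (B - C (f 0 0)) else 0) +
      (if 1 ≤ b then (if 1 ≤ b - 1 then C s⁻¹ * C τ * X * C (f (b - 1 - 1) 0) else 0)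
        else 0) := by
    intro b
    ext a
    rcases a with _ | a
    · rcases b with _ | _ | b <;>
        simp [hG, hB, coeff_zero_X_mul, mul_assoc, pow_succ]
    · have h := hf a b
      rcases b with _ | _ | b <;> rcases a with _ | a <;>
        simp [hG, hB, coeff_succ_X_mul, mul_assoc, pow_succ, coeff_C_mul, coeff_X] at h ⊢ <;>
        linear_combination h
  have hE := congrArg (rowEval c) (funext hrow)
  have hnext : X * c.i * rowEval c (fun b => G (b + 1)) = rowEval c G - A := by
    rw [← rowEval_shift, ← rowEval_single c A, ← rowEval_sub]
    congr 1
    funext b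
    rcases b with _ | b <;> simp [hG, hA]
  simp only [rowEval_add] at hE
  rw [rowEval_sub, rowEval_C, rowEval_single, rowEval_single, rowEval_mul_left, rowEval_mul_left,
    rowEval_shift c (fun b => C τ * X ^ 2 * G b), rowEval_mul_left,
    rowEval_shift c (fun b => if 1 ≤ b then C s⁻¹ * C τ * X * C (f (b - 1) 0) else 0),
    rowEval_shift c (fun b => C s⁻¹ * C τ * X * C (f b 0)), rowEval_mul_left, rowEval_C] at hE
  have hi : c.i ≠ 0 := right_ne_zero_of_mul_eq_one c.inv
  apply mul_left_cancel₀ (mul_ne_zero (X_ne_zero (R := K)) hi)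
  linear_combination -(X * c.i) * hE - X * hnext + rowEval c G * c.kernel - X * A * c.inv +
    X * c.i * C s⁻¹ * c.σ A * (c.i ^ 2 * c.prod - c.w2 * c.i * c.inv)

end Kernel

end Kreweras

namespace Kreweras
open PowerSeries

section Invariant

/-- The pair of series `phi ω₁`, `phi ω₂` is exchanged, up to a factor, by `σ`. -/
def phi {K : Type*} [Field K] (τ s γ d : K) (A B w : PowerSeries K) : PowerSeries K :=
  X ^ 2 * (w * A - C s * B) - C (s ^ 2 * γ) * X ^ 3 -
    C τ⁻¹ * (C (s * γ) * (X - 1) + C (γ - s * γ) * w) - C d * X ^ 2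

section General
variable {K : Type*} [Field K] {τ : K} (c : Curve τ)

theorem isInv_phi (hτ : τ ≠ 0) {s γ d b : K} (hs : s ≠ 0) (hγ : γ * (s ^ 3 - 1) = s)
    (hd : d * (s - 1) = -s ^ 2 * b) {A B : PowerSeries K}
    (h : X - c.w1 * A - c.σ B + C s * (B - C b) + C s⁻¹ * (c.w2 * c.i) * c.σ A = 0) :
    IsInv c 2 s (phi τ s γ d A B c.w1) (phi τ s γ d A B c.w2) := by
  have hτ' : C τ * C τ⁻¹ = (1 : PowerSeries K) := by rw [← map_mul, mul_inv_cancel₀ hτ, map_one]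
  have hs' : C s * C s⁻¹ = (1 : PowerSeries K) := by rw [← map_mul, mul_inv_cancel₀ hs, map_one]
  have hγ' := congrArg (C (R := K)) hγ
  have hd' := congrArg (C (R := K)) hd
  rw [IsInv, phi, phi]
  simp only [map_sub, map_mul, map_add, map_pow, map_neg, map_one, c.σ_X, c.σ_C, c.σ_w2] at hγ' hd' ⊢
  have e1 : c.w2 * c.i * c.σ A = C s * c.σ B + C s * (c.w1 * A) - C s ^ 2 * B - C s * X +
      C s ^ 2 * C b := by
    linear_combination C s * h - (c.w2 * c.i * c.σ A) * hs'
  have e2 : c.w1 ^ 2 * (X * c.i) ^ 2 = X ^ 2 := by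
    linear_combination X ^ 2 * (c.w1 * c.i + 1) * c.inv
  have e3 : c.w1 ^ 2 * (X * c.i) ^ 3 = X ^ 3 * c.i := by
    linear_combination X ^ 3 * c.i * (c.w1 * c.i + 1) * c.inv
  have e4 : X ^ 3 * c.i = C τ⁻¹ * (X - 1 - c.w1) := by
    linear_combination -(X ^ 3 * c.i) * hτ' - C τ⁻¹ * c.i * c.prod + C τ⁻¹ * c.w2 * c.inv +
      C τ⁻¹ * c.sum
  have e5 : c.w1 ^ 2 * (X * c.i - 1) = c.w1 + C τ * X ^ 3 := by
    linear_combination X * c.w1 * c.inv - c.quad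
  have e6 : c.w1 ^ 2 * (c.w2 * c.i) = C τ * X ^ 3 := by
    linear_combination c.w1 * c.w2 * c.inv + c.prod
  have e7 : C τ⁻¹ * (C τ * X ^ 3) = (X : PowerSeries K) ^ 3 := by
    linear_combination X ^ 3 * hτ'
  linear_combination (c.w2 * c.i * c.σ A - C s * c.σ B - C d) * e2 + X ^ 2 * e1
    - C s ^ 2 * C γ * e3 - C s ^ 2 * C γ * e4 - C τ⁻¹ * (C s * C γ) * e5 -
    C τ⁻¹ * (C γ - C s * C γ) * e6 - C γ * e7 + X ^ 2 * hd' + X ^ 3 * hγ'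

theorem constantCoeff_phi {s γ d : K} {A B w : PowerSeries K} :
    constantCoeff (phi τ s γ d A B w) = τ⁻¹ * (s * γ - (γ - s * γ) * constantCoeff w) := by
  simp [phi]; ring

theorem dser_phi (δ : IntDer K) {s γ d : K} {A B w : PowerSeries K} (hτ : δ τ = 0) (hs : δ s = 0)
    (hγ : δ γ = 0) (hw : dser δ w = 0) :
    dser δ (phi τ s γ d A B w) = X ^ 2 * (w * dser δ A - C s * dser δ B - C (δ d)) := by
  have hX : ∀ n : ℕ, dser δ (X ^ n) = 0 := fun n => by
    rw [IntDer.apply_pow, dser_X, mul_zero]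
  have hτ' : δ τ⁻¹ = 0 := by
    by_cases h0 : τ = 0
    · rw [h0, inv_zero, map_zero]
    · have h := congrArg δ (mul_inv_cancel₀ h0)
      rw [IntDer.apply_mul, IntDer.apply_one, hτ, mul_zero, add_zero] at h
      exact (mul_eq_zero.mp h).resolve_left h0
  rw [phi]
  simp only [map_sub, map_add, map_mul, map_pow, IntDer.apply_mul, IntDer.apply_pow, IntDer.apply_one, dser_C, dser_X, hw, hτ', hs, hγ,
    map_zero]
  ring

end General

variable {K : Type*} [Field K] [Algebra (PowerSeries ℂ) K] [IsFractionRing (PowerSeries ℂ) K]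

theorem inBB_phi {s γ d : K} {A B : PowerSeries K} (hA : A ∈ TA K) (hB : B ∈ TA K) :
    InBB (phi (tau K) s γ d A B (cv K).w1) (phi (tau K) s γ d A B (cv K).w2) := by
  refine ⟨X ^ 2 * (-C s * B) - C (s ^ 2 * γ) * X ^ 3 -
    C (tau K)⁻¹ * (C (s * γ) * (X - 1)) - C d * X ^ 2, ?_,
    X ^ 2 * A - C (tau K)⁻¹ * C (γ - s * γ), ?_, by rw [phi]; ring, by rw [phi]; ring⟩
  · have hX := X_mem_TA (K := K)
    exact sub_mem (sub_mem (sub_mem (mul_mem (pow_mem hX 2) (mul_mem (neg_mem (C_mem_TA s)) hB))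
      (mul_mem (C_mem_TA _) (pow_mem hX 3)))
      (mul_mem (C_mem_TA _) (mul_mem (C_mem_TA _) (sub_mem hX (one_mem _)))))
      (mul_mem (C_mem_TA _) (pow_mem hX 2))
  · exact sub_mem (mul_mem (pow_mem X_mem_TA 2) hA) (mul_mem (C_mem_TA _) (C_mem_TA _))

theorem mk_mem_TA (g : ℕ → PowerSeries ℂ) :
    (mk fun a => tt K ^ a * algebraMap (PowerSeries ℂ) K (g a)) ∈ TA K := by
  convert trK_mem_TA (K := K) (mk fun n => ∑ a ∈ Finset.range (n + 1),
    Polynomial.monomial a (coeff n (X ^ a * g a))) using 1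
  ext a
  rw [trK_apply, coeff_map, coeff_mk, tt, ← map_pow, ← map_mul]
  congr 1
  ext n
  rw [coeff_tr, coeff_mk, Polynomial.finsetSum_coeff]
  simp only [Polynomial.coeff_monomial, Finset.sum_ite_eq', Finset.mem_range]
  split_ifs with h
  · rfl
  · exact X_pow_dvd_iff.mp (dvd_mul_right _ _) n (by omega)

/-- The generating function of the walks from the origin to position `(a, b)`. -/
def walkSeries (s : ℂ) (a b : ℕ) : PowerSeries ℂ := mk fun n => walkWeight s n a b

theorem walkSeries_eq (s : ℂ) (a b : ℕ) :
    walkSeries s a b = (if a = 0 ∧ b = 0 then 1 else 0) +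
      X * ((if 1 ≤ a ∧ 1 ≤ b then walkSeries s (a - 1) (b - 1) else 0) +
        walkSeries s a (b + 1) + walkSeries s (a + 1) b +
        (if b = 0 then C s * walkSeries s 0 (a + 1) else 0) +
        (if a = 0 ∧ 2 ≤ b then C s⁻¹ * walkSeries s (b - 2) 0 else 0)) := by
  ext n
  rcases n with _ | n
  · rw [walkSeries, coeff_mk, walkWeight]
    split_ifs <;> simp
  · rw [walkSeries, coeff_mk, walkWeight, map_add, coeff_succ_X_mul]
    have h : ∀ (p : Prop) [Decidable p] (x y : PowerSeries ℂ) (m : ℕ),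
        coeff m (if p then x else y) = if p then coeff m x else coeff m y := by
      intro p _ x y m; split_ifs <;> rfl
    simp only [map_add, h, coeff_C_mul, walkSeries, coeff_mk, coeff_one, Nat.add_eq_zero_iff, one_ne_zero,
      and_false, if_false, map_zero, ite_self, zero_add]

/-- Constants in the field of fractions. -/
def cst : ℂ →+* K := (algebraMap (PowerSeries ℂ) K).comp C

/-- The generating functions, scaled so that only the cube of `t` occurs. -/
def scaledSeries (K : Type*) [Field K] [Algebra (PowerSeries ℂ) K] (s : ℂ) (a b : ℕ) : K :=
  tt K ^ (a + b) * algebraMap (PowerSeries ℂ) K (walkSeries s a b)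

theorem scaledSeries_eq (s : ℂ) (a b : ℕ) :
    scaledSeries K s a b = (if a = 0 ∧ b = 0 then 1 else 0) +
      (if 1 ≤ a ∧ 1 ≤ b then tau K * scaledSeries K s (a - 1) (b - 1) else 0) +
      scaledSeries K s a (b + 1) + scaledSeries K s (a + 1) b +
      (if b = 0 then cst s * scaledSeries K s 0 (a + 1) else 0) +
      (if a = 0 ∧ 2 ≤ b then (cst s)⁻¹ * (tau K * scaledSeries K s (b - 2) 0) else 0) := by
  have hτ : tau K = tt K ^ 3 := by rw [tau, tt, map_pow]
  have h := congrArg (algebraMap (PowerSeries ℂ) K) (walkSeries_eq s a b)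
  have hite : ∀ (p : Prop) [Decidable p] (x : PowerSeries ℂ),
      algebraMap (PowerSeries ℂ) K (if p then x else 0) =
        if p then algebraMap (PowerSeries ℂ) K x else 0 := by
    intro p _ x; split_ifs
    · rfl
    · exact map_zero _
  have hinv : algebraMap (PowerSeries ℂ) K (C s⁻¹) = (cst s)⁻¹ := map_inv₀ cst s
  simp only [map_add, map_mul, hite, map_one, hinv] at h
  rw [show algebraMap (PowerSeries ℂ) K (C s) = cst s from rfl,
    show algebraMap (PowerSeries ℂ) K X = tt K from rfl] at h
  simp only [scaledSeries]
  rw [h, hτ]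
  rcases a with _ | a <;> rcases b with _ | _ | b <;> simp <;> ring

end Invariant

end Kreweras

namespace Kreweras
open PowerSeries

section NoDerivation
variable {K : Type*} [Field K] [Algebra (PowerSeries ℂ) K] [IsFractionRing (PowerSeries ℂ) K]

/-- No derivation annihilating `t` and the constants takes the value `1` at the excursion series. -/
theorem derivation_walkSeries_ne_one [CharZero K] {s : ℂ} {m : ℕ} (hm : m ≠ 0) (hsm : s ^ m = 1)
    (hs3 : s ^ 3 ≠ 1) (δ : IntDer K) (ht : δ (tt K) = 0) (hc : ∀ z : ℂ, δ (cst z) = 0) :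
    δ (algebraMap (PowerSeries ℂ) K (walkSeries s 0 0)) ≠ 1 := by
  intro hδ
  have hs : s ≠ 0 := by
    rintro rfl
    rw [zero_pow hm] at hsm
    exact zero_ne_one hsm
  have hs1 : s ≠ 1 := by
    rintro rfl
    exact hs3 (one_pow 3)
  have hτt : tau K = tt K ^ 3 := by rw [tau, tt, map_pow]
  have hτ : δ (tau K) = 0 := by rw [hτt, IntDer.apply_pow, ht, mul_zero]
  have hτ0 : tau K ≠ 0 := by rw [hτt]; exact pow_ne_zero 3 (tt_ne_zero K)
  have h27 : 1 - 27 * tau K ≠ 0 := by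
    have h : (1 - 27 * X ^ 3 : PowerSeries ℂ) ≠ 0 := by
      intro h
      have := congrArg constantCoeff h
      simp at this
    have h' := (map_ne_zero_iff (algebraMap (PowerSeries ℂ) K)
      (IsFractionRing.injective _ _)).mpr h
    rwa [map_sub, map_mul, map_one, map_ofNat] at h'
  have hσ0 : (cst s : K) ≠ 0 := (map_ne_zero cst).mpr hs
  have hσ1 : (cst s : K) - 1 ≠ 0 := by
    rw [sub_ne_zero, ← map_one cst]
    exact fun h => hs1 (cst.injective h)
  set γ : ℂ := s / (s ^ 3 - 1) with hγ
  have hγ0 : γ ≠ 0 := div_ne_zero hs (sub_ne_zero.mpr hs3)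
  have hγ' : (cst γ : K) * (cst s ^ 3 - 1) = cst s := by
    rw [← map_one cst, ← map_pow, ← map_sub, ← map_mul, hγ, div_mul_cancel₀ _ (sub_ne_zero.mpr hs3)]
  set b : K := algebraMap (PowerSeries ℂ) K (walkSeries s 0 0) with hb
  set d : K := (-cst s ^ 2 * b) / (cst s - 1) with hd
  have hd' : d * (cst s - 1) = -cst s ^ 2 * b := div_mul_cancel₀ _ hσ1
  set A : PowerSeries K := mk fun a => scaledSeries K s a 0 with hA
  set B : PowerSeries K := mk (scaledSeries K s 0) with hB
  have hbb : scaledSeries K s 0 0 = b := by simp [scaledSeries, hb]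
  have hker := kernel_equation (cv K) (scaledSeries_eq (K := K) s)
  rw [hbb] at hker
  have hinv := isInv_phi (cv K) hτ0 hσ0 hγ' hd' hker
  have hAT : A ∈ TA K := mk_mem_TA fun a => walkSeries s a 0
  have hBT : B ∈ TA K := by
    have h := mk_mem_TA (K := K) fun a => walkSeries s 0 a
    convert h using 2
    funext a
    rw [scaledSeries, zero_add]
  have hBB := inBB_phi (s := cst s) (γ := cst γ) (d := d) hAT hBT
  obtain ⟨hw1, hw2⟩ := dser_w δ (cv K) hτ w1_ne_w2
  have hcγ : (cst γ : K) ≠ 0 := (map_ne_zero cst).mpr hγ0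
  have hf : constantCoeff (phi (tau K) (cst s) (cst γ) d A B (cv K).w1) ≠ 0 := by
    rw [constantCoeff_phi, (cv K).const,
      show cst s * cst γ - (cst γ - cst s * cst γ) * -1 = (cst γ : K) by ring]
    exact mul_ne_zero (inv_ne_zero hτ0) hcγ
  have hg : constantCoeff (phi (tau K) (cst s) (cst γ) d A B (cv K).w2) ≠ 0 := by
    rw [constantCoeff_phi, (cv K).constantCoeff_w2, mul_zero, sub_zero]
    exact mul_ne_zero (inv_ne_zero hτ0) (mul_ne_zero hσ0 hcγ)
  have hF := dser_phi δ (d := d) (A := A) (B := B) hτ (hc s) (hc γ) hw1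
  have hG := dser_phi δ (d := d) (A := A) (B := B) hτ (hc s) (hc γ) hw2
  have h0 := dser_eq_zero_of_isInv δ hτ hτ0 h27 hBB hm hsm hs1 hinv hf hg hF hG
  rw [hF] at h0
  have h1 := (mul_eq_zero.mp h0).resolve_left (pow_ne_zero 2 X_ne_zero)
  have hA0 : constantCoeff (dser δ A) = 1 := by
    rw [← coeff_zero_eq_constantCoeff_apply, coeff_dser, hA, coeff_mk, hbb, hδ]
  have hB0 : constantCoeff (dser δ B) = 1 := by
    rw [← coeff_zero_eq_constantCoeff_apply, coeff_dser, hB, coeff_mk, hbb, hδ]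
  have h2 := congrArg constantCoeff h1
  simp only [map_sub, map_mul, constantCoeff_C, hA0, hB0, (cv K).const, map_zero] at h2
  have h3 := congrArg δ hd'
  rw [IntDer.apply_mul, map_sub, hc, IntDer.apply_one, IntDer.apply_mul, map_neg,
    IntDer.apply_pow, hc, hδ] at h3
  have h4 : (1 : K) = 0 := by
    linear_combination (cst s - 1) * h2 + h3
  exact one_ne_zero h4

end NoDerivation

end Kreweras

namespace Kreweras

/-- A derivation on a domain extends to any algebraic field extension in characteristic zero. -/
theorem exists_derivation_extending {k R E : Type} [CommRing k] [CommRing R] [IsDomain R]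
    [Field E] [CharZero E] [Algebra k R] [Algebra R E] [Algebra k E] [IsScalarTower k R E]
    [FaithfulSMul R E] [Algebra.IsAlgebraic R E] (D : Derivation k R E) :
    ∃ δ : Derivation k E E, ∀ r, δ (algebraMap R E r) = D r := by
  let _ := FractionRing.liftAlgebra R E
  have := FractionRing.isScalarTower_liftAlgebra R E
  have : Algebra.IsAlgebraic (FractionRing R) E :=
    (IsFractionRing.comap_isAlgebraic_iff (A := R) (K := FractionRing R) (C := E)).mp inferInstance
  have : CharZero (FractionRing R) :=
    (RingHom.charZero_iff (algebraMap (FractionRing R) E).injective).mpr inferInstance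
  have : Algebra.FormallyEtale (FractionRing R) E := Algebra.FormallyEtale.of_isSeparable _ _
  have : Algebra.FormallyEtale R (FractionRing R) :=
    Algebra.FormallyEtale.of_isLocalization (nonZeroDivisors R)
  have : Algebra.FormallyEtale R E := Algebra.FormallyEtale.comp R (FractionRing R) E
  refine ⟨((D.liftKaehlerDifferential.liftBaseChange E).comp
    (KaehlerDifferential.tensorKaehlerEquivOfFormallyEtale k R E).symm.toLinearMap).compDer
      (KaehlerDifferential.D k E), fun r => ?_⟩
  simp [KaehlerDifferential.tensorKaehlerEquivOfFormallyEtale_symm_D_algebraMap]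

/-- In characteristic zero, a derivation can be prescribed freely on a transcendence basis. -/
theorem exists_derivation_of_isTranscendenceBasis {k E ι : Type} [Field k] [Field E] [CharZero E]
    [Algebra k E] {x : ι → E} (hx : IsTranscendenceBasis k x) (v : ι → E) :
    ∃ δ : Derivation k E E, ∀ i, δ (x i) = v i := by
  let _ : Algebra (MvPolynomial ι k) E := (MvPolynomial.aeval x).toAlgebra
  have : IsScalarTower k (MvPolynomial ι k) E :=
    IsScalarTower.of_algebraMap_eq fun r => ((MvPolynomial.aeval x).commutes r).symm
  have : FaithfulSMul (MvPolynomial ι k) E :=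
    (faithfulSMul_iff_algebraMap_injective _ _).mpr hx.1
  have := hx.isAlgebraic
  have : Algebra.IsAlgebraic (MvPolynomial ι k) E :=
    Algebra.IsAlgebraic.of_ringHom_of_comp_eq (S := Algebra.adjoin k (Set.range x)) (B := E)
      hx.1.aevalEquiv (RingHom.id E) 
      hx.1.aevalEquiv.surjective Function.injective_id (by
        refine RingHom.ext fun r => ?_
        simp [RingHom.algebraMap_toAlgebra])
  obtain ⟨δ, hδ⟩ := exists_derivation_extending (MvPolynomial.mkDerivation k v)
  refine ⟨δ, fun i => ?_⟩
  have h := hδ (MvPolynomial.X i)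
  rwa [MvPolynomial.mkDerivation_X,
    show algebraMap (MvPolynomial ι k) E (MvPolynomial.X i) = x i from
      MvPolynomial.aeval_X x i] at h

/-- Two algebraically independent elements are separated by a derivation. -/
theorem exists_derivation_of_algebraicIndependent {k E : Type} [Field k] [Field E] [CharZero E]
    [Algebra k E] {a b : E} (h : AlgebraicIndependent k ![a, b]) :
    ∃ δ : Derivation k E E, δ a = 0 ∧ δ b = 1 := by
  classical
  have hab : a ≠ b := fun hab => by
    simpa using h.injective (show ![a, b] 0 = ![a, b] 1 by simpa using hab)
  obtain ⟨t, hst, ht⟩ := exists_isTranscendenceBasis_superset h.coe_range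
  have ha : a ∈ t := hst ⟨0, rfl⟩
  have hb : b ∈ t := hst ⟨1, rfl⟩
  obtain ⟨δ, hδ⟩ := exists_derivation_of_isTranscendenceBasis ht
    fun i => if (i : E) = b then 1 else 0
  exact ⟨δ, by simpa [hab] using hδ ⟨a, ha⟩, by simpa using hδ ⟨b, hb⟩⟩

theorem not_algebraicIndependent_walkSeries {s : ℂ} {m : ℕ} (hm : m ≠ 0) (hsm : s ^ m = 1)
    (hs3 : s ^ 3 ≠ 1) :
    ¬ AlgebraicIndependent ℂ ![(PowerSeries.X : PowerSeries ℂ), walkSeries s 0 0] := by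
  intro h
  let K := FractionRing (PowerSeries ℂ)
  have : CharZero K := charZero_of_injective_algebraMap (algebraMap ℂ K).injective
  have hK := h.map' (f := IsScalarTower.toAlgHom ℂ (PowerSeries ℂ) K)
    (IsFractionRing.injective (PowerSeries ℂ) K)
  have hK' : AlgebraicIndependent ℂ
      ![tt K, algebraMap (PowerSeries ℂ) K (walkSeries s 0 0)] := by
    convert hK using 1
    ext i
    fin_cases i <;> rfl
  obtain ⟨δ, h0, h1⟩ := exists_derivation_of_algebraicIndependent hK'
  refine derivation_walkSeries_ne_one (K := K) hm hsm hs3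
    (IntDer.ofAddMonoidHom (δ : K →ₗ[ℂ] K).toAddMonoidHom δ.leibniz) h0 (fun z => ?_) h1
  have hz : (cst z : K) = algebraMap ℂ K z :=
    (IsScalarTower.algebraMap_apply ℂ (PowerSeries ℂ) K z).symm
  rw [hz]
  exact δ.map_algebraMap z

theorem exists_polynomial_of_walkSeries (s : ℂ) (hs : ∃ m : ℕ, 0 < m ∧ s ^ m = 1)
    (hs3 : s ^ 3 ≠ 1) :
    ∃ P : MvPolynomial (Fin 2) ℂ, P ≠ 0 ∧
      MvPolynomial.aeval
        ![(PowerSeries.X : PowerSeries ℂ),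
          PowerSeries.mk fun n => ∑' k : ℤ, (eVert n k : ℂ) * s ^ k] P = 0 := by
  obtain ⟨m, hm, hsm⟩ := hs
  have hs0 : s ≠ 0 := by
    rintro rfl
    simp [hm.ne'] at hsm
  have hW : (PowerSeries.mk fun n => ∑' k : ℤ, (eVert n k : ℂ) * s ^ k) = walkSeries s 0 0 := by
    simp only [tsum_eVert hs0]
    rfl
  rw [hW]
  have h := not_algebraicIndependent_walkSeries hm.ne' hsm hs3
  rw [algebraicIndependent_iff] at h
  push Not at h
  obtain ⟨P, hP, hP0⟩ := h
  exact ⟨P, hP0, hP⟩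

end Kreweras

/-- Corollary 3, vertex-centred case: for a root of unity `s` with `s³ ≠ 1`,
the power series `Ẽ(t,s)` is algebraic over `ℂ(t)`. -/
theorem vertex_generating_function_algebraic
    (s : ℂ) (hs : ∃ m : ℕ, 0 < m ∧ s ^ m = 1) (hs3 : s ^ 3 ≠ 1) :
    ∃ P : MvPolynomial (Fin 2) ℂ, P ≠ 0 ∧
      MvPolynomial.aeval
        ![(PowerSeries.X : PowerSeries ℂ),
          PowerSeries.mk fun n => ∑' k : ℤ, (eVert n k : ℂ) * s ^ k] P = 0 :=
    Kreweras.exists_polynomial_of_walkSeries s hs hs3
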